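/- arXiv:2310.08264 — 2 statements merged into one kernel-verified Lean document; each statement's English description precedes it below -/
import Mathlib

section
/- Let n ≥ 2 be an even integer and 0 < μ < n. Suppose u ∈ Cⁿ(ℝⁿ) satisfies the higher-order Choquard equation ((−Δ)^{n/2} u)(x) = v(x) e^{((2n−μ)/2) u(x)} for all x ∈ ℝⁿ, where (−Δ)^{n/2} denotes the (n/2)-fold iterate of the negative Laplacian. Assume ∫_{ℝⁿ} e^{((2n−μ)/2) u(y)} dy < ∞ and ∫_{ℝⁿ} v(y) e^{((2n−μ)/2) u(y)} dy < ∞, and, in case n ≥ 3, that u(x) = o(|x|²) as |x| → ∞. Then there exists a constant C such that u(x) = (1/βₙ) ∫_{ℝⁿ} ln((|y|+1)/|x−y|) v(y) e^{((2n−μ)/2) u(y)} dy + C for all x ∈ ℝⁿ. -/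
open MeasureTheory Real Filter Metric

noncomputable section

/-- The nonlocal term `v(x) = ∫ e^{((2n-μ)/2) u(y)} / |x-y|^μ dy`. -/
noncomputable def V (n : ℕ) (μ : ℝ) (u : EuclideanSpace ℝ (Fin n) → ℝ)
    (x : EuclideanSpace ℝ (Fin n)) : ℝ :=
  ∫ y : EuclideanSpace ℝ (Fin n),
    Real.exp ((2 * n - μ) / 2 * u y) / ‖x - y‖ ^ μ

/-- `βₙ = 2^{n-1} Γ(n/2+1) Γ(n/2) ωₙ` with `ωₙ` the volume of the unit ball in `ℝⁿ`. -/
noncomputable def betaN (n : ℕ) : ℝ :=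
  2 ^ (n - 1) * Real.Gamma ((n : ℝ) / 2 + 1) * Real.Gamma ((n : ℝ) / 2) *
    (volume (Metric.ball (0 : EuclideanSpace ℝ (Fin n)) 1)).toReal

/-- Condition (B): finite weighted volume and finite total curvature. -/
def CondB (n : ℕ) (μ : ℝ) (u : EuclideanSpace ℝ (Fin n) → ℝ) : Prop :=
  Integrable (fun y : EuclideanSpace ℝ (Fin n) => Real.exp ((2 * n - μ) / 2 * u y)) ∧
  Integrable (fun p : EuclideanSpace ℝ (Fin n) × EuclideanSpace ℝ (Fin n) =>
    Real.exp ((2 * n - μ) / 2 * u p.1) * Real.exp ((2 * n - μ) / 2 * u p.2) / ‖p.1 - p.2‖ ^ μ)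

/-- The integral equation (IE). -/
def IE (n : ℕ) (μ : ℝ) (u : EuclideanSpace ℝ (Fin n) → ℝ) : Prop :=
  ∃ C : ℝ, ∀ x : EuclideanSpace ℝ (Fin n), u x = (1 / betaN n) *
    (∫ y, Real.log ((‖y‖ + 1) / ‖x - y‖) * (V n μ u y * Real.exp ((2 * n - μ) / 2 * u y))) + C

/-- `α = (1/βₙ) ∫ v(y) e^{((2n-μ)/2) u(y)} dy`. -/
noncomputable def alphaC (n : ℕ) (μ : ℝ) (u : EuclideanSpace ℝ (Fin n) → ℝ) : ℝ :=
  (1 / betaN n) * ∫ y, V n μ u y * Real.exp ((2 * n - μ) / 2 * u y)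

/-- The Laplacian of `f : ℝⁿ → ℝ` computed coordinatewise via Fréchet derivatives. -/
noncomputable def lap (n : ℕ) (f : EuclideanSpace ℝ (Fin n) → ℝ)
    (x : EuclideanSpace ℝ (Fin n)) : ℝ :=
  ∑ i : Fin n,
    fderiv ℝ (fun y => fderiv ℝ f y (EuclideanSpace.single i (1 : ℝ))) x
      (EuclideanSpace.single i (1 : ℝ))

/-- The `k`-fold iterate of the negative Laplacian `(-Δ)^k`. -/
noncomputable def negLapIter (n k : ℕ) (f : EuclideanSpace ℝ (Fin n) → ℝ) :
    EuclideanSpace ℝ (Fin n) → ℝ :=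
  (fun g x => -(lap n g x))^[k] f

/-- `βₙ = 2^{n-1} (n/2)! ((n/2)-1)! ωₙ` (for even `n`). -/
noncomputable def betaNFact (n : ℕ) : ℝ :=
  2 ^ (n - 1) * (Nat.factorial (n / 2) : ℝ) * (Nat.factorial (n / 2 - 1) : ℝ) *
    (volume (Metric.ball (0 : EuclideanSpace ℝ (Fin n)) 1)).toReal

/-! ### Elementary calculus of the coordinate Laplacian and its iterates -/

lemma negLapIter_zero (n : ℕ) (f : EuclideanSpace ℝ (Fin n) → ℝ) : negLapIter n 0 f = f := rfl

lemma negLapIter_succ (n k : ℕ) (f : EuclideanSpace ℝ (Fin n) → ℝ) :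
    negLapIter n (k + 1) f = fun x => -(lap n (negLapIter n k f) x) := by
  unfold negLapIter
  rw [Function.iterate_succ_apply']

lemma ContDiff.fderiv_apply_const {E : Type*} [NormedAddCommGroup E] [NormedSpace ℝ E]
    {f : E → ℝ} {k : ℕ} (hf : ContDiff ℝ (k + 1 : ℕ) f) (v : E) :
    ContDiff ℝ k (fun y => fderiv ℝ f y v) :=
  (hf.fderiv_right (m := k) (by norm_cast)).clm_apply contDiff_const

lemma ContDiff.lap {n k : ℕ} {f : EuclideanSpace ℝ (Fin n) → ℝ}
    (hf : ContDiff ℝ (k + 2 : ℕ) f) : ContDiff ℝ k (lap n f) := by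
  unfold _root_.lap
  refine ContDiff.sum fun i _ => ?_
  exact (hf.fderiv_apply_const (k := k + 1) _).fderiv_apply_const _

lemma ContDiff.negLapIter {n : ℕ} (k j : ℕ) {f : EuclideanSpace ℝ (Fin n) → ℝ}
    (hf : ContDiff ℝ (2 * k + j : ℕ) f) : ContDiff ℝ j (negLapIter n k f) := by
  induction k generalizing j with
  | zero => simpa [negLapIter_zero] using hf
  | succ k ih =>
    rw [negLapIter_succ]
    refine ContDiff.neg (ContDiff.lap (ih (j + 2) ?_))
    convert hf using 2
    ring

lemma Filter.EventuallyEq.lap {n : ℕ} {f g : EuclideanSpace ℝ (Fin n) → ℝ}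
    {x : EuclideanSpace ℝ (Fin n)} (h : f =ᶠ[nhds x] g) : lap n f =ᶠ[nhds x] lap n g := by
  have h2 : ∀ i : Fin n, ∀ᶠ z in nhds x,
      fderiv ℝ (fun y => fderiv ℝ f y (EuclideanSpace.single i (1 : ℝ))) z
        (EuclideanSpace.single i (1 : ℝ)) =
      fderiv ℝ (fun y => fderiv ℝ g y (EuclideanSpace.single i (1 : ℝ))) z
        (EuclideanSpace.single i (1 : ℝ)) := by
    intro i
    have h3 : (fun y => fderiv ℝ f y (EuclideanSpace.single i (1 : ℝ))) =ᶠ[nhds x]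
        (fun y => fderiv ℝ g y (EuclideanSpace.single i (1 : ℝ))) := by
      filter_upwards [h.fderiv (𝕜 := ℝ)] with z hz
      rw [hz]
    filter_upwards [h3.fderiv (𝕜 := ℝ)] with z hz
    rw [hz]
  filter_upwards [Filter.eventually_all.2 h2] with z hz
  exact Finset.sum_congr rfl fun i _ => hz i

lemma Filter.EventuallyEq.negLapIter {n : ℕ} (k : ℕ) {f g : EuclideanSpace ℝ (Fin n) → ℝ}
    {x : EuclideanSpace ℝ (Fin n)} (h : f =ᶠ[nhds x] g) :
    negLapIter n k f =ᶠ[nhds x] negLapIter n k g := by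
  induction k with
  | zero => exact h
  | succ k ih =>
    rw [negLapIter_succ, negLapIter_succ]
    filter_upwards [ih.lap] with z hz
    rw [hz]

lemma HasCompactSupport.lap {n : ℕ} {f : EuclideanSpace ℝ (Fin n) → ℝ}
    (hf : HasCompactSupport f) : HasCompactSupport (lap n f) := by
  refine HasCompactSupport.intro hf fun x hx => ?_
  have h0 : f =ᶠ[nhds x] fun _ => (0 : ℝ) := notMem_tsupport_iff_eventuallyEq.1 hx
  have := h0.lap.eq_of_nhds
  rw [this]
  simp [_root_.lap]

lemma HasCompactSupport.negLapIter {n : ℕ} (k : ℕ) {f : EuclideanSpace ℝ (Fin n) → ℝ}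
    (hf : HasCompactSupport f) : HasCompactSupport (negLapIter n k f) := by
  induction k with
  | zero => exact hf
  | succ k ih =>
    rw [negLapIter_succ]
    exact ih.lap.neg

lemma lap_const_mul (n : ℕ) (a : ℝ) (f : EuclideanSpace ℝ (Fin n) → ℝ)
    (x : EuclideanSpace ℝ (Fin n)) : lap n (fun z => a * f z) x = a * lap n f x := by
  have h : ∀ (g : EuclideanSpace ℝ (Fin n) → ℝ) (y v : EuclideanSpace ℝ (Fin n)),
      fderiv ℝ (fun z => a * g z) y v = a * fderiv ℝ g y v := by
    intro g y v
    have := congrFun (fderiv_const_smul_field (𝕜 := ℝ) (f := g) a) y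
    have h2 : (a • g) = fun z => a * g z := by ext; simp
    rw [h2] at this
    rw [this]; simp
  unfold lap
  simp_rw [h, Finset.mul_sum]

lemma lap_comp_add_smul (n : ℕ) (x : EuclideanSpace ℝ (Fin n)) (c : ℝ)
    (f : EuclideanSpace ℝ (Fin n) → ℝ) (z : EuclideanSpace ℝ (Fin n)) :
    lap n (fun z => f (x + c • z)) z = c ^ 2 * lap n f (x + c • z) := by
  have h : ∀ (g : EuclideanSpace ℝ (Fin n) → ℝ) (y v : EuclideanSpace ℝ (Fin n)),
      fderiv ℝ (fun z => g (x + c • z)) y v = c * fderiv ℝ g (x + c • y) v := by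
    intro g y v
    have h1 := fderiv_comp_smul (𝕜 := ℝ) (f := fun w => g (x + w)) (x := y) c
    rw [h1, fderiv_comp_add_left]; simp
  have h' : ∀ (g : EuclideanSpace ℝ (Fin n) → ℝ) (y v : EuclideanSpace ℝ (Fin n)),
      fderiv ℝ (fun z => c * g (x + c • z)) y v = c * (c * fderiv ℝ g (x + c • y) v) := by
    intro g y v
    rw [← h g]
    have := congrFun (fderiv_const_smul_field (𝕜 := ℝ) (f := fun z => g (x + c • z)) c) y
    have h2 : (c • fun z => g (x + c • z)) = fun z => c * g (x + c • z) := by ext; simp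
    rw [h2] at this
    rw [this]; simp
  unfold lap
  rw [Finset.mul_sum]
  refine Finset.sum_congr rfl fun i _ => ?_
  simp_rw [h]
  rw [h' (fun y => fderiv ℝ f y (EuclideanSpace.single i (1 : ℝ)))]
  ring

lemma negLapIter_comp_add_smul (n k : ℕ) (x : EuclideanSpace ℝ (Fin n)) (c : ℝ)
    (f : EuclideanSpace ℝ (Fin n) → ℝ) :
    negLapIter n k (fun z => f (x + c • z)) =
      fun z => c ^ (2 * k) * negLapIter n k f (x + c • z) := by
  induction k with
  | zero => simp [negLapIter_zero]
  | succ k ih =>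
    rw [negLapIter_succ, ih, negLapIter_succ]
    ext z
    rw [lap_const_mul, lap_comp_add_smul]
    ring

lemma integral_mul_fderiv_eq_neg {n : ℕ} {f g : EuclideanSpace ℝ (Fin n) → ℝ}
    (hf : ContDiff ℝ 1 f) (hg : ContDiff ℝ 1 g) (hc : HasCompactSupport f ∨ HasCompactSupport g)
    (v : EuclideanSpace ℝ (Fin n)) :
    ∫ x, f x * fderiv ℝ g x v = -∫ x, fderiv ℝ f x v * g x := by
  have hf1 : Continuous fun x => fderiv ℝ f x v :=
    (hf.continuous_fderiv one_ne_zero).clm_apply continuous_const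
  have hg1 : Continuous fun x => fderiv ℝ g x v :=
    (hg.continuous_fderiv one_ne_zero).clm_apply continuous_const
  refine integral_mul_fderiv_eq_neg_fderiv_mul_of_integrable ?_ ?_ ?_
    (fun x _ => hf.differentiable one_ne_zero x) (fun x _ => hg.differentiable one_ne_zero x)
  · refine (hf1.mul hg.continuous).integrable_of_hasCompactSupport ?_
    exact hc.elim (fun h => (h.fderiv_apply ℝ v).mul_right) (fun h => h.mul_left)
  · refine (hf.continuous.mul hg1).integrable_of_hasCompactSupport ?_
    exact hc.elim (fun h => h.mul_right) (fun h => (h.fderiv_apply ℝ v).mul_left)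
  · refine (hf.continuous.mul hg.continuous).integrable_of_hasCompactSupport ?_
    exact hc.elim (fun h => h.mul_right) (fun h => h.mul_left)

lemma integral_mul_lap {n : ℕ} {f g : EuclideanSpace ℝ (Fin n) → ℝ}
    (hf : ContDiff ℝ 2 f) (hg : ContDiff ℝ 2 g) (hc : HasCompactSupport g) :
    ∫ x, f x * lap n g x = ∫ x, lap n f x * g x := by
  have hf1 : ∀ v, ContDiff ℝ 1 fun x => fderiv ℝ f x v := fun v =>
    ContDiff.fderiv_apply_const (k := 1) (by exact_mod_cast hf) v
  have hg1 : ∀ v, ContDiff ℝ 1 fun x => fderiv ℝ g x v := fun v =>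
    ContDiff.fderiv_apply_const (k := 1) (by exact_mod_cast hg) v
  have c2 : ∀ {h : EuclideanSpace ℝ (Fin n) → ℝ}, ContDiff ℝ 1 h → ∀ v,
      Continuous fun x => fderiv ℝ h x v := fun hh v =>
    (hh.continuous_fderiv one_ne_zero).clm_apply continuous_const
  unfold lap
  simp_rw [Finset.mul_sum, Finset.sum_mul]
  rw [integral_finsetSum, integral_finsetSum]
  · refine Finset.sum_congr rfl fun i _ => ?_
    rw [integral_mul_fderiv_eq_neg (hf.of_le (by norm_num)) (hg1 _)
        (Or.inr (hc.fderiv_apply ℝ _)),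
      integral_mul_fderiv_eq_neg (hf1 _) (hg.of_le (by norm_num)) (Or.inr hc), neg_neg]
  · intro i _
    exact ((c2 (hf1 _) _).mul hg.continuous).integrable_of_hasCompactSupport hc.mul_left
  · intro i _
    exact (hf.continuous.mul (c2 (hg1 _) _)).integrable_of_hasCompactSupport
      ((hc.fderiv_apply ℝ _).fderiv_apply ℝ _).mul_left

lemma integral_mul_negLapIter {n : ℕ} (k : ℕ) {f g : EuclideanSpace ℝ (Fin n) → ℝ}
    (hf : ContDiff ℝ (2 * k : ℕ) f) (hg : ContDiff ℝ (2 * k : ℕ) g) (hc : HasCompactSupport g) :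
    ∫ x, f x * negLapIter n k g x = ∫ x, negLapIter n k f x * g x := by
  induction k generalizing f with
  | zero => rfl
  | succ k ih =>
    have hg2 : ContDiff ℝ 2 (negLapIter n k g) :=
      ContDiff.negLapIter k 2 (by convert hg using 2; ring)
    have hf2 : ContDiff ℝ (2 * k : ℕ) (lap n f) := ContDiff.lap (by convert hf using 2; ring)
    have e : negLapIter n (k + 1) f = negLapIter n k (fun x => -(lap n f x)) := by
      unfold negLapIter; rw [Function.iterate_succ_apply]
    rw [e, negLapIter_succ, ← ih (f := fun x => -(lap n f x)) hf2.neg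
      (hg.of_le (by norm_cast; omega))]
    simp only [mul_neg, neg_mul, integral_neg]
    rw [integral_mul_lap (hf.of_le (by norm_cast; omega)) hg2 (hc.negLapIter k)]

lemma lap_comp_norm_sq (n : ℕ) {T T1 T2 : ℝ → ℝ} (h1 : ∀ s, 0 ≤ s → HasDerivAt T (T1 s) s)
    (h2 : ∀ s, 0 ≤ s → HasDerivAt T1 (T2 s) s) (x : EuclideanSpace ℝ (Fin n)) :
    lap n (fun z => T (‖z‖ ^ 2)) x = 4 * ‖x‖ ^ 2 * T2 (‖x‖ ^ 2) + 2 * n * T1 (‖x‖ ^ 2) := by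
  have hd : ∀ {U U1 : ℝ → ℝ}, (∀ s, 0 ≤ s → HasDerivAt U (U1 s) s) →
      ∀ y : EuclideanSpace ℝ (Fin n), HasFDerivAt (fun z : EuclideanSpace ℝ (Fin n) => U (‖z‖ ^ 2))
        (U1 (‖y‖ ^ 2) • (2 • (innerSL ℝ) y)) y := by
    intro U U1 hU y
    exact (hU (‖y‖ ^ 2) (by positivity)).comp_hasFDerivAt y
      (hasStrictFDerivAt_norm_sq y).hasFDerivAt
  have e1 : ∀ i : Fin n, ∀ y : EuclideanSpace ℝ (Fin n),
      fderiv ℝ (fun z => T (‖z‖ ^ 2)) y (EuclideanSpace.single i (1 : ℝ)) =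
        T1 (‖y‖ ^ 2) * (2 * y i) := by
    intro i y
    rw [(hd h1 y).fderiv]
    simp [EuclideanSpace.inner_single_right]
  unfold lap
  simp_rw [e1]
  have e2 : ∀ i : Fin n, fderiv ℝ (fun y : EuclideanSpace ℝ (Fin n) => T1 (‖y‖ ^ 2) * (2 * y i)) x
      (EuclideanSpace.single i (1 : ℝ)) =
        4 * T2 (‖x‖ ^ 2) * (x i) ^ 2 + 2 * T1 (‖x‖ ^ 2) := by
    intro i
    have hc : HasFDerivAt (fun y : EuclideanSpace ℝ (Fin n) => 2 * y i)
        ((2 : ℝ) • (EuclideanSpace.proj i : EuclideanSpace ℝ (Fin n) →L[ℝ] ℝ)) x := by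
      exact ((EuclideanSpace.proj i : EuclideanSpace ℝ (Fin n) →L[ℝ] ℝ).hasFDerivAt).const_mul 2
    have hm := HasFDerivAt.fun_mul (hd h2 x) hc
    rw [hm.fderiv]
    simp [EuclideanSpace.inner_single_right]
    ring
  simp_rw [e2]
  rw [Finset.sum_add_distrib, ← Finset.mul_sum, EuclideanSpace.norm_sq_eq]
  simp
  ring

/-! ### Iterated Laplacians of the regularised logarithm -/

/-- Coefficients of `(-Δ)^{k+1} (-log (ε + |z|²) / 2)` in dimension `2 m`. -/
def logCoeff (m k j : ℕ) : ℝ :=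
  1 / 2 * 4 ^ (k + 1) * (Nat.factorial (k + j) : ℝ) * (Nat.choose (k + 1) j : ℝ) *
    ∏ i ∈ Finset.Ico (j + 1) (k + 2), ((m : ℝ) - i)

lemma logCoeff_succ_zero (m k : ℕ) :
    logCoeff m (k + 1) 0 = 4 * (k + 1) * (m - k - 2) * logCoeff m k 0 := by
  unfold logCoeff
  rw [Finset.prod_Ico_succ_top (by omega : 0 + 1 ≤ k + 2)]
  simp only [add_zero, Nat.choose_zero_right, Nat.factorial_succ]
  push_cast
  ring

lemma logCoeff_succ_succ (m k j : ℕ) (hj : j < k + 2) :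
    logCoeff m (k + 1) (j + 1) = 4 * (k + j + 2) * (m - k - j - 3) * logCoeff m k (j + 1) +
      4 * (k + j + 1) * (k + j + 2) * logCoeff m k j := by
  unfold logCoeff
  have f1 : k + 1 + (j + 1) = k + j + 1 + 1 := by ring
  have f2 : k + (j + 1) = k + j + 1 := by ring
  rw [f1, f2, Nat.factorial_succ (k + j + 1), Nat.factorial_succ (k + j)]
  rcases Nat.lt_succ_iff_lt_or_eq.1 hj with h | h
  · rw [Finset.prod_Ico_succ_top (by omega : j + 1 + 1 ≤ k + 1 + 1),
      Finset.prod_eq_prod_Ico_succ_bot (by omega : j + 1 < k + 2)]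
    have hc : (Nat.choose (k + 1) (j + 1) : ℝ) * (j + 1) =
        (Nat.choose (k + 1) j : ℝ) * (k + 1 - j) := by
      have := Nat.choose_succ_right_eq (k + 1) j
      have h2 : ((k + 1 - j : ℕ) : ℝ) = k + 1 - j := by
        rw [Nat.cast_sub (by omega)]; push_cast; ring
      rw [← h2]
      exact_mod_cast this
    rw [Nat.choose_succ_succ' (k + 1) j]
    push_cast
    set Q := ∏ i ∈ Finset.Ico (j + 1 + 1) (k + 2), ((m : ℝ) - i)
    set F : ℝ := (Nat.factorial (k + j) : ℝ)
    linear_combination ((1 / 2 : ℝ) * 4 ^ (k + 2) * (k + j + 2) * (k + j + 1) * F * Q) * hc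
  · subst h
    simp [Nat.choose_succ_self]
    ring

lemma hasDerivAt_inv_pow_add {ε s : ℝ} (h : 0 < ε + s) (p : ℕ) :
    HasDerivAt (fun s : ℝ => ((ε + s) ^ p)⁻¹) (-(p * ((ε + s) ^ (p + 1))⁻¹)) s := by
  have h1 : HasDerivAt (fun s : ℝ => ε + s) 1 s := (hasDerivAt_id s).const_add ε
  have h2 := (h1.pow p).inv (pow_ne_zero p h.ne')
  refine h2.congr_deriv ?_
  rcases p with _ | p
  · simp
  · simp
    field_simp
    ring

lemma lap_sum_inv_pow (n : ℕ) {ε : ℝ} (hε : 0 < ε) (N : ℕ) (c : ℕ → ℝ) (q : ℕ)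
    (x : EuclideanSpace ℝ (Fin n)) :
    lap n (fun z => ∑ j ∈ Finset.range N, c j * ((ε + ‖z‖ ^ 2) ^ (q + j))⁻¹) x =
      ∑ j ∈ Finset.range N, c j *
        (-(2 * (q + j) * (n - 2 * (q + j) - 2)) * ((ε + ‖x‖ ^ 2) ^ (q + j + 1))⁻¹ -
          4 * ε * (q + j) * (q + j + 1) * ((ε + ‖x‖ ^ 2) ^ (q + j + 2))⁻¹) := by
  have hd1 : ∀ s : ℝ, 0 ≤ s → HasDerivAt
      (fun s : ℝ => ∑ j ∈ Finset.range N, c j * ((ε + s) ^ (q + j))⁻¹)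
      (∑ j ∈ Finset.range N, c j * (-((q + j : ℕ) * ((ε + s) ^ (q + j + 1))⁻¹))) s := by
    intro s hs
    exact HasDerivAt.fun_sum fun j _ => (hasDerivAt_inv_pow_add (by linarith) (q + j)).const_mul _
  have hd2 : ∀ s : ℝ, 0 ≤ s → HasDerivAt
      (fun s : ℝ => ∑ j ∈ Finset.range N, c j * (-((q + j : ℕ) * ((ε + s) ^ (q + j + 1))⁻¹)))
      (∑ j ∈ Finset.range N, c j * (-((q + j : ℕ) *
        (-((q + j + 1 : ℕ) * ((ε + s) ^ (q + j + 1 + 1))⁻¹))))) s := by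
    intro s hs
    exact HasDerivAt.fun_sum fun j _ =>
      (((hasDerivAt_inv_pow_add (by linarith) (q + j + 1)).const_mul _).neg).const_mul _
  rw [lap_comp_norm_sq n hd1 hd2, Finset.mul_sum, Finset.mul_sum, ← Finset.sum_add_distrib]
  refine Finset.sum_congr rfl fun j _ => ?_
  have hp : ε + ‖x‖ ^ 2 ≠ 0 := by positivity
  have e1 : ((ε + ‖x‖ ^ 2) ^ (q + j + 1))⁻¹ =
      (ε + ‖x‖ ^ 2) * ((ε + ‖x‖ ^ 2) ^ (q + j + 2))⁻¹ := by
    field_simp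
    ring
  rw [e1]
  push_cast
  ring

lemma negLapIter_log_succ (m k : ℕ) {ε : ℝ} (hε : 0 < ε) :
    negLapIter (2 * m) (k + 1) (fun z => -(1 / 2) * Real.log (ε + ‖z‖ ^ 2)) =
      fun z => ∑ j ∈ Finset.range (k + 2),
        (logCoeff m k j * ε ^ j) * ((ε + ‖z‖ ^ 2) ^ (k + 1 + j))⁻¹ := by
  induction k with
  | zero =>
    rw [negLapIter_succ, negLapIter_zero]
    ext x
    have hd1 : ∀ s : ℝ, 0 ≤ s → HasDerivAt (fun s : ℝ => -(1 / 2) * Real.log (ε + s))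
        (-(1 / 2) * ((ε + s) ^ 1)⁻¹) s := by
      intro s hs
      have h1 : HasDerivAt (fun s : ℝ => ε + s) 1 s := (hasDerivAt_id s).const_add ε
      refine ((h1.log (by linarith)).const_mul _).congr_deriv ?_
      simp
    have hd2 : ∀ s : ℝ, 0 ≤ s → HasDerivAt (fun s : ℝ => -(1 / 2) * ((ε + s) ^ 1)⁻¹)
        (-(1 / 2) * (-((1 : ℕ) * ((ε + s) ^ 2)⁻¹))) s := by
      intro s hs
      exact (hasDerivAt_inv_pow_add (by linarith) 1).const_mul _
    rw [lap_comp_norm_sq (2 * m) hd1 hd2]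
    have hp : ε + ‖x‖ ^ 2 ≠ 0 := by positivity
    simp [Finset.sum_range_succ, logCoeff]
    field_simp
    ring
  | succ k ih =>
    rw [negLapIter_succ, ih]
    ext x
    have := lap_sum_inv_pow (2 * m) hε (k + 2) (fun j => logCoeff m k j * ε ^ j) (k + 1) x
    rw [this, ← Finset.sum_neg_distrib, Finset.sum_range_succ' _ (k + 2)]
    have hz : logCoeff m k (k + 2) = 0 := by simp [logCoeff]
    set X : ℕ → ℝ := fun p => ((ε + ‖x‖ ^ 2) ^ p)⁻¹ with hX
    have e1 : ∑ j ∈ Finset.range (k + 2), logCoeff m k j * ε ^ j *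
          (4 * (k + 1 + j) * (m - (k + 1 + j) - 1)) * X (k + 1 + j + 1) =
        ∑ j ∈ Finset.range (k + 2), logCoeff m k (j + 1) * ε ^ (j + 1) *
          (4 * (k + 1 + (j + 1 : ℕ)) * (m - (k + 1 + (j + 1 : ℕ)) - 1)) * X (k + 1 + (j + 1) + 1) +
        logCoeff m k 0 * (4 * (k + 1) * (m - (k + 1) - 1)) * X (k + 1 + 1) := by
      have := Finset.sum_range_succ' (fun j : ℕ => logCoeff m k j * ε ^ j *
          (4 * (k + 1 + j) * (m - (k + 1 + j) - 1)) * X (k + 1 + j + 1)) (k + 2)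
      rw [Finset.sum_range_succ, hz] at this
      simpa using this
    have e2 : ∑ j ∈ Finset.range (k + 2), -(logCoeff m k j * ε ^ j *
        (-(2 * (((k + 1 : ℕ) : ℝ) + j) * (((2 * m : ℕ) : ℝ) - 2 * (((k + 1 : ℕ) : ℝ) + j) - 2)) *
            ((ε + ‖x‖ ^ 2) ^ (k + 1 + j + 1))⁻¹ -
          4 * ε * (((k + 1 : ℕ) : ℝ) + j) * (((k + 1 : ℕ) : ℝ) + j + 1) *
            ((ε + ‖x‖ ^ 2) ^ (k + 1 + j + 2))⁻¹)) =
        ∑ j ∈ Finset.range (k + 2), logCoeff m k j * ε ^ j *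
          (4 * (k + 1 + j) * (m - (k + 1 + j) - 1)) * X (k + 1 + j + 1) +
        ∑ j ∈ Finset.range (k + 2), logCoeff m k j * ε ^ (j + 1) *
          (4 * (k + 1 + j) * (k + 1 + j + 1)) * X (k + 1 + j + 2) := by
      rw [← Finset.sum_add_distrib]
      refine Finset.sum_congr rfl fun j _ => ?_
      simp only [hX]
      push_cast
      ring
    rw [e2, e1, add_right_comm, ← Finset.sum_add_distrib]
    congr 1
    · refine Finset.sum_congr rfl fun j hj => ?_
      rw [logCoeff_succ_succ m k j (Finset.mem_range.1 hj)]
      have i1 : k + 1 + (j + 1) + 1 = k + j + 3 := by ring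
      have i2 : k + 1 + j + 2 = k + j + 3 := by ring
      have i3 : k + 1 + 1 + (j + 1) = k + j + 3 := by ring
      rw [i1, i2, i3]
      push_cast
      ring
    · rw [logCoeff_succ_zero]
      simp only [hX, add_zero, pow_zero]
      ring

lemma negLapIter_log (m : ℕ) (hm : 1 ≤ m) {ε : ℝ} (hε : 0 < ε)
    (z : EuclideanSpace ℝ (Fin (2 * m))) :
    negLapIter (2 * m) m (fun z => -(1 / 2) * Real.log (ε + ‖z‖ ^ 2)) z =
      1 / 2 * 4 ^ m * (Nat.factorial (2 * m - 1) : ℝ) * (ε ^ m * ((ε + ‖z‖ ^ 2) ^ (2 * m))⁻¹) := by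
  obtain ⟨k, rfl⟩ : ∃ k, m = k + 1 := ⟨m - 1, by omega⟩
  rw [negLapIter_log_succ (k + 1) k hε]
  simp only
  rw [Finset.sum_range_succ, Finset.sum_eq_zero, zero_add]
  · have i1 : k + 1 + (k + 1) = 2 * (k + 1) := by ring
    have i2 : k + (k + 1) = 2 * (k + 1) - 1 := by omega
    rw [logCoeff, i1, i2]
    simp
    ring
  · intro j hj
    have : logCoeff (k + 1) k j = 0 := by
      unfold logCoeff
      rw [Finset.prod_eq_zero (i := k + 1)]
      · simp
      · have := Finset.mem_range.1 hj
        simp; omega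
      · simp
    rw [this]; simp

/-! ### Total mass of the bubble -/

lemma bubble_radial_integral (p q : ℕ) :
    IntegrableOn (fun r : ℝ => r ^ (2 * p + 1) * ((1 + r ^ 2) ^ (p + q + 2))⁻¹) (Set.Ioi 0) ∧
    ∫ r in Set.Ioi (0 : ℝ), r ^ (2 * p + 1) * ((1 + r ^ 2) ^ (p + q + 2))⁻¹ =
      1 / 2 * (Nat.factorial p : ℝ) * (Nat.factorial q : ℝ) / (Nat.factorial (p + q + 1) : ℝ) := by
  have hder : ∀ (N : ℕ) (r : ℝ), HasDerivAt (fun r : ℝ => ((1 + r ^ 2) ^ N)⁻¹)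
      (-(N * ((1 + r ^ 2) ^ (N + 1))⁻¹) * (2 * r)) r := by
    intro N r
    have h1 := hasDerivAt_inv_pow_add (ε := 1) (s := r ^ 2) (by positivity) N
    have h2 := HasDerivAt.comp (h := fun r : ℝ => r ^ 2) r h1 (hasDerivAt_pow 2 r)
    refine h2.congr_deriv ?_
    simp
  have hlim : ∀ a b : ℕ, a < 2 * b →
      Tendsto (fun r : ℝ => r ^ a * ((1 + r ^ 2) ^ b)⁻¹) atTop (nhds 0) := by
    intro a b hab
    have h1 : Tendsto (fun r : ℝ => r⁻¹) atTop (nhds 0) := tendsto_inv_atTop_zero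
    refine squeeze_zero' (g := fun r : ℝ => r⁻¹) ?_ ?_ h1
    · filter_upwards [eventually_ge_atTop 0] with r hr
      positivity
    · filter_upwards [eventually_ge_atTop 1] with r hr
      rw [← div_eq_mul_inv, div_le_iff₀ (by positivity), ← div_eq_inv_mul,
        le_div_iff₀ (by positivity), ← pow_succ]
      calc r ^ (a + 1) ≤ r ^ (2 * b) := pow_le_pow_right₀ hr (by omega)
        _ = (r ^ 2) ^ b := by rw [pow_mul]
        _ ≤ (1 + r ^ 2) ^ b := by gcongr; linarith
  induction p with
  | zero =>
    have hd : ∀ r ∈ Set.Ici (0 : ℝ), HasDerivAt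
        (fun r : ℝ => -(1 / (2 * ((q : ℝ) + 1))) * ((1 + r ^ 2) ^ (q + 1))⁻¹)
        (r ^ (2 * 0 + 1) * ((1 + r ^ 2) ^ (0 + q + 2))⁻¹) r := by
      intro r _
      refine ((hder (q + 1) r).const_mul _).congr_deriv ?_
      have : (q : ℝ) + 1 ≠ 0 := by positivity
      push_cast
      rw [show 0 + q + 2 = q + 1 + 1 by ring]
      field_simp
    have hl : Tendsto (fun r : ℝ => -(1 / (2 * ((q : ℝ) + 1))) * ((1 + r ^ 2) ^ (q + 1))⁻¹) atTop
        (nhds 0) := by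
      have := (hlim 0 (q + 1) (by omega)).const_mul (-(1 / (2 * ((q : ℝ) + 1))))
      simpa using this
    have hpos : ∀ r ∈ Set.Ioi (0 : ℝ), 0 ≤ r ^ (2 * 0 + 1) * ((1 + r ^ 2) ^ (0 + q + 2))⁻¹ := by
      intro r hr
      have : 0 < r := hr
      positivity
    refine ⟨integrableOn_Ioi_deriv_of_nonneg' hd hpos hl, ?_⟩
    rw [integral_Ioi_of_hasDerivAt_of_nonneg' hd hpos hl]
    have : (Nat.factorial q : ℝ) ≠ 0 := by positivity
    have h3 : (q : ℝ) + 1 ≠ 0 := by positivity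
    simp [Nat.factorial_succ]
    field_simp
  | succ p ih =>
    obtain ⟨ih1, ih2⟩ := ih
    have hi : IntegrableOn
        (fun r : ℝ => r ^ (2 * (p + 1) + 1) * ((1 + r ^ 2) ^ (p + 1 + q + 2))⁻¹) (Set.Ioi 0) := by
      refine Integrable.mono' ih1 ?_ ?_
      · refine Continuous.aestronglyMeasurable ?_
        refine Continuous.mul (by fun_prop) (Continuous.inv₀ (by fun_prop) fun r => by positivity)
      · refine (ae_restrict_iff' measurableSet_Ioi).2 (Eventually.of_forall fun r hr => ?_)
        have hr0 : 0 < r := hr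
        rw [Real.norm_of_nonneg (by positivity), ← div_eq_mul_inv, ← div_eq_mul_inv,
          div_le_div_iff₀ (by positivity) (by positivity)]
        calc r ^ (2 * (p + 1) + 1) * (1 + r ^ 2) ^ (p + q + 2)
            = r ^ (2 * p + 1) * (r ^ 2 * (1 + r ^ 2) ^ (p + q + 2)) := by ring
          _ ≤ r ^ (2 * p + 1) * ((1 + r ^ 2) * (1 + r ^ 2) ^ (p + q + 2)) := by
              gcongr; linarith
          _ = _ := by ring
    refine ⟨hi, ?_⟩
    have hd : ∀ r ∈ Set.Ici (0 : ℝ), HasDerivAt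
        (fun r : ℝ => r ^ (2 * p + 2) * ((1 + r ^ 2) ^ (p + q + 2))⁻¹)
        ((2 * p + 2) * (r ^ (2 * p + 1) * ((1 + r ^ 2) ^ (p + q + 2))⁻¹) -
          2 * (p + q + 2) * (r ^ (2 * (p + 1) + 1) * ((1 + r ^ 2) ^ (p + 1 + q + 2))⁻¹)) r := by
      intro r _
      refine ((hasDerivAt_pow (2 * p + 2) r).mul (hder (p + q + 2) r)).congr_deriv ?_
      rw [show p + 1 + q + 2 = p + q + 2 + 1 by ring, show 2 * p + 2 - 1 = 2 * p + 1 by omega]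
      push_cast
      ring
    have hl := hlim (2 * p + 2) (p + q + 2) (by omega)
    have hint := integral_Ioi_of_hasDerivAt_of_tendsto' hd
      ((ih1.const_mul _).sub (hi.const_mul _)) hl
    rw [integral_sub (ih1.const_mul _) (hi.const_mul _), integral_const_mul, integral_const_mul,
      ih2] at hint
    have h3 : (p : ℝ) + q + 2 ≠ 0 := by positivity
    have h4 : (Nat.factorial (p + q + 1) : ℝ) ≠ 0 := by positivity
    rw [show p + 1 + q + 1 = p + q + 1 + 1 by ring, Nat.factorial_succ (p + q + 1),
      Nat.factorial_succ p]
    simp at hint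
    push_cast
    have h5 : (p : ℝ) + q + 1 + 1 ≠ 0 := by positivity
    have h6 : 2 * ((p : ℝ) + q + 2) * (∫ r in Set.Ioi (0 : ℝ),
        r ^ (2 * (p + 1) + 1) * ((1 + r ^ 2) ^ (p + 1 + q + 2))⁻¹) =
        (2 * p + 2) * (1 / 2 * (Nat.factorial p : ℝ) * (Nat.factorial q : ℝ) /
          (Nat.factorial (p + q + 1) : ℝ)) := by
      linarith [hint]
    rw [eq_div_iff (by positivity)]
    field_simp at h6 ⊢
    linear_combination h6

lemma bubble_integral (m : ℕ) (hm : 1 ≤ m) :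
    Integrable (fun z : EuclideanSpace ℝ (Fin (2 * m)) => ((1 + ‖z‖ ^ 2) ^ (2 * m))⁻¹) ∧
    1 / 2 * 4 ^ m * (Nat.factorial (2 * m - 1) : ℝ) *
      ∫ z : EuclideanSpace ℝ (Fin (2 * m)), ((1 + ‖z‖ ^ 2) ^ (2 * m))⁻¹ = betaNFact (2 * m) := by
  obtain ⟨k, rfl⟩ : ∃ k, m = k + 1 := ⟨m - 1, by omega⟩
  obtain ⟨h1, h2⟩ := bubble_radial_integral k k
  have hfr : Module.finrank ℝ (EuclideanSpace ℝ (Fin (2 * (k + 1)))) - 1 = 2 * k + 1 := by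
    simp; omega
  have : Nontrivial (EuclideanSpace ℝ (Fin (2 * (k + 1)))) :=
    Module.nontrivial_of_finrank_pos (R := ℝ) (by simp)
  have hk : k + k + 2 = 2 * (k + 1) := by ring
  rw [hk] at h1 h2
  constructor
  · have := integrable_fun_norm_addHaar
      (volume : Measure (EuclideanSpace ℝ (Fin (2 * (k + 1)))))
      (f := fun r : ℝ => ((1 + r ^ 2) ^ (2 * (k + 1)))⁻¹)
    rw [this, hfr]
    exact h1
  · have := integral_fun_norm_addHaar
      (volume : Measure (EuclideanSpace ℝ (Fin (2 * (k + 1)))))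
      (fun r : ℝ => ((1 + r ^ 2) ^ (2 * (k + 1)))⁻¹)
    rw [this, hfr]
    simp only [smul_eq_mul]
    rw [h2, betaNFact]
    have i1 : 2 * (k + 1) - 1 = k + k + 1 := by omega
    have i2 : 2 * (k + 1) / 2 = k + 1 := by omega
    have i3 : k + 1 - 1 = k := by omega
    rw [i1, i2, i3, Nat.factorial_succ k]
    have h4 : (Nat.factorial (k + k + 1) : ℝ) ≠ 0 := by positivity
    have h5 : (4 : ℝ) ^ (k + 1) = 2 * 2 ^ (k + k + 1) := by
      rw [show (4 : ℝ) = 2 ^ 2 by norm_num, ← pow_mul]; ring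
    rw [h5]
    simp [Measure.real]
    field_simp

/-! ### The fundamental solution -/

lemma locallyIntegrable_inv_norm (m : ℕ) (hm : 1 ≤ m) :
    LocallyIntegrable (fun z : EuclideanSpace ℝ (Fin (2 * m)) => ‖z‖⁻¹) := by
  refine locallyIntegrable_of_norm_le_rpow (C := 1) (α := 1) (by simp; omega) ?_ ?_ ?_
  · simp; exact_mod_cast (by omega : 1 < 2 * m)
  · refine Eventually.of_forall fun z => ?_
    rw [Real.rpow_neg_one]; simp
  · exact (measurable_norm.inv).aestronglyMeasurable

lemma abs_log_le_inv_add {r : ℝ} (hr : 0 ≤ r) : |Real.log r| ≤ r⁻¹ + r := by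
  rcases hr.eq_or_lt with h | h
  · simp [← h]
  · have h1 : Real.log r ≤ r - 1 := Real.log_le_sub_one_of_pos h
    have h2 : Real.log r⁻¹ ≤ r⁻¹ - 1 := Real.log_le_sub_one_of_pos (inv_pos.2 h)
    rw [Real.log_inv] at h2
    have h3 : 0 < r⁻¹ := inv_pos.2 h
    rw [abs_le]
    constructor <;> linarith

lemma contDiff_log_add_norm_sq (n : ℕ) {ε : ℝ} (hε : 0 < ε) {k : WithTop ℕ∞} :
    ContDiff ℝ k (fun z : EuclideanSpace ℝ (Fin n) => -(1 / 2) * Real.log (ε + ‖z‖ ^ 2)) := by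
  refine contDiff_const.mul (ContDiff.log ?_ fun z => by positivity)
  exact contDiff_const.add (contDiff_norm_sq ℝ)

lemma ae_ne_zero_euclidean (m : ℕ) (hm : 1 ≤ m) (x : EuclideanSpace ℝ (Fin (2 * m))) :
    ∀ᵐ z : EuclideanSpace ℝ (Fin (2 * m)), z ≠ x := by
  have : Nontrivial (EuclideanSpace ℝ (Fin (2 * m))) :=
    Module.nontrivial_of_finrank_pos (R := ℝ) (by simp; omega)
  exact Measure.ae_ne volume x

lemma tendsto_integral_log_add_norm_sq (m : ℕ) (hm : 1 ≤ m)
    {g : EuclideanSpace ℝ (Fin (2 * m)) → ℝ} (hg : Continuous g) (hc : HasCompactSupport g) :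
    Tendsto (fun δ : ℝ => ∫ z, -(1 / 2) * Real.log (δ ^ 2 + ‖z‖ ^ 2) * g z)
      (nhdsWithin 0 (Set.Ioi 0)) (nhds (∫ z, -Real.log ‖z‖ * g z)) := by
  have hb : Integrable (fun z : EuclideanSpace ℝ (Fin (2 * m)) =>
      (‖z‖⁻¹ + (1 + ‖z‖ ^ 2)) * |g z|) := by
    have h1 : LocallyIntegrable (fun z : EuclideanSpace ℝ (Fin (2 * m)) =>
        ‖z‖⁻¹ + (1 + ‖z‖ ^ 2)) :=
      (locallyIntegrable_inv_norm m hm).add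
        (Continuous.locallyIntegrable (by fun_prop))
    have := h1.integrable_smul_right_of_hasCompactSupport hg.abs
      (hc.comp_left (g := fun t : ℝ => |t|) (by simp))
    simpa using this
  have hev : ∀ᶠ δ : ℝ in nhdsWithin 0 (Set.Ioi 0), 0 < δ ∧ δ ≤ 1 := by
    have h1 : ∀ᶠ δ : ℝ in nhdsWithin 0 (Set.Ioi 0), 0 < δ := self_mem_nhdsWithin
    have h2 : ∀ᶠ δ : ℝ in nhdsWithin 0 (Set.Ioi 0), δ ≤ 1 :=
      nhdsWithin_le_nhds (eventually_le_nhds (by norm_num))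
    exact h1.and h2
  refine tendsto_integral_filter_of_dominated_convergence _ ?_ ?_ hb ?_
  · filter_upwards [hev] with δ hδ
    refine Continuous.aestronglyMeasurable ?_
    refine Continuous.mul ?_ hg
    exact (contDiff_log_add_norm_sq (2 * m) (k := 0) (pow_pos hδ.1 2)).continuous
  · filter_upwards [hev] with δ hδ
    filter_upwards [ae_ne_zero_euclidean m hm 0] with z hz
    have hr : 0 < ‖z‖ := norm_pos_iff.2 hz
    rw [norm_mul, Real.norm_eq_abs, Real.norm_eq_abs]
    refine mul_le_mul_of_nonneg_right ?_ (abs_nonneg _)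
    have h1 : Real.log (δ ^ 2 + ‖z‖ ^ 2) ≤ δ ^ 2 + ‖z‖ ^ 2 - 1 :=
      Real.log_le_sub_one_of_pos (by positivity)
    have h2 : Real.log (‖z‖ ^ 2) ≤ Real.log (δ ^ 2 + ‖z‖ ^ 2) :=
      Real.log_le_log (by positivity) (by nlinarith [hδ.1])
    rw [Real.log_pow] at h2
    have h3 : Real.log ‖z‖⁻¹ ≤ ‖z‖⁻¹ - 1 := Real.log_le_sub_one_of_pos (inv_pos.2 hr)
    rw [Real.log_inv] at h3
    have h4 : δ ^ 2 ≤ 1 := pow_le_one₀ hδ.1.le hδ.2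
    have h5 : 0 < ‖z‖⁻¹ := inv_pos.2 hr
    push_cast at h2
    rw [abs_le]
    constructor <;> nlinarith
  · filter_upwards [ae_ne_zero_euclidean m hm 0] with z hz
    have hr : 0 < ‖z‖ := norm_pos_iff.2 hz
    refine Tendsto.mul_const _ ?_
    have h1 : Tendsto (fun δ : ℝ => δ ^ 2 + ‖z‖ ^ 2) (nhdsWithin 0 (Set.Ioi 0))
        (nhds (‖z‖ ^ 2)) := by
      have : Tendsto (fun δ : ℝ => δ ^ 2 + ‖z‖ ^ 2) (nhds 0) (nhds (0 ^ 2 + ‖z‖ ^ 2)) :=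
        (Continuous.tendsto (by fun_prop) 0)
      simpa using this.mono_left nhdsWithin_le_nhds
    have h2 := (h1.log (by positivity)).const_mul (-(1 / 2))
    convert h2 using 2
    rw [Real.log_pow]; push_cast; ring

lemma integral_log_norm_mul_negLapIter (m : ℕ) (hm : 1 ≤ m)
    {φ : EuclideanSpace ℝ (Fin (2 * m)) → ℝ} (hφ : ContDiff ℝ (2 * m : ℕ) φ)
    (hc : HasCompactSupport φ) :
    ∫ z, -Real.log ‖z‖ * negLapIter (2 * m) m φ z = betaNFact (2 * m) * φ 0 := by
  have hφc : Continuous (negLapIter (2 * m) m φ) :=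
    (ContDiff.negLapIter m 0 (by simpa using hφ)).continuous
  have hl := tendsto_integral_log_add_norm_sq m hm hφc (hc.negLapIter m)
  refine tendsto_nhds_unique hl ?_
  obtain ⟨hB1, hB2⟩ := bubble_integral m hm
  set c : ℝ := 1 / 2 * 4 ^ m * (Nat.factorial (2 * m - 1) : ℝ)
  have hfr : Module.finrank ℝ (EuclideanSpace ℝ (Fin (2 * m))) = 2 * m := by simp
  have he : ∀ δ : ℝ, 0 < δ →
      ∫ z, -(1 / 2) * Real.log (δ ^ 2 + ‖z‖ ^ 2) * negLapIter (2 * m) m φ z =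
      c * ∫ y : EuclideanSpace ℝ (Fin (2 * m)), ((1 + ‖y‖ ^ 2) ^ (2 * m))⁻¹ * φ (δ • y) := by
    intro δ hδ
    rw [integral_mul_negLapIter m (contDiff_log_add_norm_sq _ (pow_pos hδ 2)) hφ hc]
    simp_rw [negLapIter_log m hm (pow_pos hδ 2)]
    have h1 := Measure.integral_comp_smul (volume : Measure (EuclideanSpace ℝ (Fin (2 * m))))
      (fun z => c * ((δ ^ 2) ^ m * ((δ ^ 2 + ‖z‖ ^ 2) ^ (2 * m))⁻¹) * φ z) δ
    rw [hfr, abs_of_pos (by positivity), smul_eq_mul] at h1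
    have h2 : ∀ y : EuclideanSpace ℝ (Fin (2 * m)),
        c * ((δ ^ 2) ^ m * ((δ ^ 2 + ‖δ • y‖ ^ 2) ^ (2 * m))⁻¹) * φ (δ • y) =
        (δ ^ (2 * m))⁻¹ * (c * (((1 + ‖y‖ ^ 2) ^ (2 * m))⁻¹ * φ (δ • y))) := by
      intro y
      have : δ ^ 2 + ‖δ • y‖ ^ 2 = δ ^ 2 * (1 + ‖y‖ ^ 2) := by
        rw [norm_smul, Real.norm_of_nonneg hδ.le]; ring
      rw [this, mul_pow, mul_inv, ← pow_mul]
      field_simp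
      ring
    simp_rw [h2] at h1
    rw [integral_const_mul, integral_const_mul] at h1
    exact (mul_left_cancel₀ (by positivity) h1).symm
  have hlim : Tendsto (fun δ : ℝ => c * ∫ y : EuclideanSpace ℝ (Fin (2 * m)),
      ((1 + ‖y‖ ^ 2) ^ (2 * m))⁻¹ * φ (δ • y)) (nhdsWithin 0 (Set.Ioi 0))
      (nhds (betaNFact (2 * m) * φ 0)) := by
    rw [← hB2, mul_assoc, ← integral_mul_const]
    refine Tendsto.const_mul _ ?_
    obtain ⟨C, hC⟩ := hc.exists_bound_of_continuous hφ.continuous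
    have hcont : Continuous fun y : EuclideanSpace ℝ (Fin (2 * m)) =>
        ((1 + ‖y‖ ^ 2) ^ (2 * m))⁻¹ :=
      Continuous.inv₀ (by fun_prop) fun r => by positivity
    refine tendsto_integral_filter_of_dominated_convergence
      (fun y => ((1 + ‖y‖ ^ 2) ^ (2 * m))⁻¹ * C) ?_ ?_ (hB1.mul_const C) ?_
    · refine Eventually.of_forall fun δ => ?_
      exact (hcont.mul (hφ.continuous.comp (by fun_prop))).aestronglyMeasurable
    · refine Eventually.of_forall fun δ => Eventually.of_forall fun y => ?_
      rw [norm_mul, Real.norm_of_nonneg (by positivity)]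
      exact mul_le_mul_of_nonneg_left (hC _) (by positivity)
    · refine Eventually.of_forall fun y => Tendsto.const_mul _ ?_
      have : Continuous fun δ : ℝ => φ (δ • y) := hφ.continuous.comp (by fun_prop)
      have h2 := this.tendsto 0
      simp only [zero_smul] at h2
      exact h2.mono_left nhdsWithin_le_nhds
  refine hlim.congr' ?_
  filter_upwards [self_mem_nhdsWithin] with δ hδ
  exact (he δ hδ).symm

/-! ### A truncated representation formula -/

lemma integral_comp_add_neg_smul (m : ℕ) (F : EuclideanSpace ℝ (Fin (2 * m)) → ℝ)
    (x : EuclideanSpace ℝ (Fin (2 * m))) {R : ℝ} (hR : 0 < R) :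
    ∫ z, F (x + (-R) • z) = (R ^ (2 * m))⁻¹ * ∫ y, F y := by
  have h1 := Measure.integral_comp_smul (volume : Measure (EuclideanSpace ℝ (Fin (2 * m))))
    (fun z => F (x + z)) (-R)
  have hfr : Module.finrank ℝ (EuclideanSpace ℝ (Fin (2 * m))) = 2 * m := by simp
  rw [h1, hfr, integral_add_left_eq_self, smul_eq_mul, Even.neg_pow (by simp),
    abs_of_pos (by positivity)]

lemma truncated_representation (m : ℕ) (hm : 1 ≤ m)
    {u S χ : EuclideanSpace ℝ (Fin (2 * m)) → ℝ} (hu : ContDiff ℝ (2 * m : ℕ) u)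
    (hS : ContDiff ℝ (2 * m : ℕ) S) (hSlog : ∀ z, 1 ≤ ‖z‖ → S z = -Real.log ‖z‖)
    (hχ : ContDiff ℝ (2 * m : ℕ) χ) (hχc : HasCompactSupport χ) (hχ1 : ∀ z, ‖z‖ < 1 → χ z = 1)
    (x : EuclideanSpace ℝ (Fin (2 * m))) {R : ℝ} (hR : 0 < R) :
    betaNFact (2 * m) * u x =
      (∫ y, (-Real.log ‖R⁻¹ • (x - y)‖ - S (R⁻¹ • (x - y))) * negLapIter (2 * m) m u y) +
      ∫ z, negLapIter (2 * m) m S z * χ z * u (x + (-R) • z) := by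
  have hux : ContDiff ℝ (2 * m : ℕ) (fun z => u (x + (-R) • z)) :=
    hu.comp (contDiff_const.add (contDiff_id.const_smul (-R)))
  set φ : EuclideanSpace ℝ (Fin (2 * m)) → ℝ := fun z => χ z * u (x + (-R) • z) with hφdef
  have hφ : ContDiff ℝ (2 * m : ℕ) φ := hχ.mul hux
  have hφc : HasCompactSupport φ := hχc.mul_right
  have hL : Continuous (negLapIter (2 * m) m φ) :=
    (ContDiff.negLapIter m 0 (by simpa using hφ)).continuous
  have hLc := hφc.negLapIter m
  have h0 := integral_log_norm_mul_negLapIter m hm hφ hφc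
  have hφ0 : φ 0 = u x := by simp [hφdef, hχ1 0 (by simp)]
  have hi1 : Integrable fun z => -Real.log ‖z‖ * negLapIter (2 * m) m φ z := by
    have h1 : LocallyIntegrable (fun z : EuclideanSpace ℝ (Fin (2 * m)) => ‖z‖⁻¹ + ‖z‖) :=
      (locallyIntegrable_inv_norm m hm).add
        (Continuous.locallyIntegrable (by fun_prop))
    have h2 := h1.integrable_smul_right_of_hasCompactSupport hL.abs
      (hLc.comp_left (g := fun t : ℝ => |t|) (by simp))
    refine Integrable.mono' h2 ?_ (Eventually.of_forall fun z => ?_)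
    · exact ((measurable_norm.log.neg).mul hL.measurable).aestronglyMeasurable
    · rw [norm_mul, norm_neg, Real.norm_eq_abs, Real.norm_eq_abs, smul_eq_mul]
      exact mul_le_mul_of_nonneg_right (abs_log_le_inv_add (norm_nonneg _)) (abs_nonneg _)
  have hi2 : Integrable fun z => S z * negLapIter (2 * m) m φ z :=
    (hS.continuous.mul hL).integrable_of_hasCompactSupport hLc.mul_left
  have hsplit : ∫ z, -Real.log ‖z‖ * negLapIter (2 * m) m φ z =
      (∫ z, (-Real.log ‖z‖ - S z) * negLapIter (2 * m) m φ z) +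
      ∫ z, S z * negLapIter (2 * m) m φ z := by
    have : ∀ z, (-Real.log ‖z‖ - S z) * negLapIter (2 * m) m φ z =
        -Real.log ‖z‖ * negLapIter (2 * m) m φ z - S z * negLapIter (2 * m) m φ z :=
      fun z => by ring
    simp_rw [this]
    rw [integral_sub hi1 hi2]
    ring
  have hloc : ∀ z, (-Real.log ‖z‖ - S z) * negLapIter (2 * m) m φ z =
      R ^ (2 * m) * ((fun y => (-Real.log ‖R⁻¹ • (x - y)‖ - S (R⁻¹ • (x - y))) *
        negLapIter (2 * m) m u y) (x + (-R) • z)) := by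
    intro z
    have e1 : R⁻¹ • (x - (x + (-R) • z)) = z := by
      rw [sub_add_cancel_left, neg_smul, neg_neg, smul_smul, inv_mul_cancel₀ hR.ne', one_smul]
    simp only [e1]
    rcases le_or_gt 1 ‖z‖ with h | h
    · rw [hSlog z h]; ring
    · have hev : φ =ᶠ[nhds z] fun z => u (x + (-R) • z) := by
        have : ∀ᶠ w in nhds z, ‖w‖ < 1 :=
          (continuous_norm.tendsto z).eventually (eventually_lt_nhds h)
        filter_upwards [this] with w hw
        simp [hφdef, hχ1 w hw]
      rw [(hev.negLapIter m).eq_of_nhds, negLapIter_comp_add_smul, Even.neg_pow (by simp)]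
      ring
  rw [hφ0] at h0
  rw [← h0, hsplit, integral_mul_negLapIter m hS hφ hφc]
  have hloc' := integral_comp_add_neg_smul m (fun y => (-Real.log ‖R⁻¹ • (x - y)‖ -
    S (R⁻¹ • (x - y))) * negLapIter (2 * m) m u y) x hR
  rw [integral_congr_ae (Eventually.of_forall hloc), integral_const_mul, hloc', ← mul_assoc,
    mul_inv_cancel₀ (by positivity), one_mul]
  congr 1
  refine integral_congr_ae (Eventually.of_forall fun z => ?_)
  simp only [hφdef]
  ring

/-! ### The logarithmic potential -/

lemma integrable_inv_norm_mul (m : ℕ) (hm : 1 ≤ m) {f : EuclideanSpace ℝ (Fin (2 * m)) → ℝ}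
    (hf : Continuous f) (hi : Integrable f) (x : EuclideanSpace ℝ (Fin (2 * m))) :
    Integrable fun y => ‖x - y‖⁻¹ * f y := by
  suffices h : ∀ g : EuclideanSpace ℝ (Fin (2 * m)) → ℝ, Continuous g → Integrable g →
      Integrable fun z => ‖z‖⁻¹ * g z by
    have := (h (fun z => f (x - z)) (by fun_prop) (hi.comp_sub_left x)).comp_sub_left x
    simpa using this
  intro g hg hgi
  have hmeas : AEStronglyMeasurable (fun z : EuclideanSpace ℝ (Fin (2 * m)) => ‖z‖⁻¹ * g z) :=
    (measurable_norm.inv.mul hg.measurable).aestronglyMeasurable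
  rw [← integrableOn_univ, ← Set.union_compl_self (closedBall 0 1), integrableOn_union]
  constructor
  · have h1 : IntegrableOn (fun z : EuclideanSpace ℝ (Fin (2 * m)) => ‖z‖⁻¹) (closedBall 0 1) :=
      (locallyIntegrable_inv_norm m hm).integrableOn_isCompact (isCompact_closedBall 0 1)
    exact h1.mul_continuousOn hg.continuousOn (isCompact_closedBall 0 1)
  · refine Integrable.mono' hgi.norm.integrableOn hmeas.restrict ?_
    refine (ae_restrict_iff' measurableSet_closedBall.compl).2 (Eventually.of_forall fun z hz => ?_)
    have hz1 : 1 < ‖z‖ := by simpa using hz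
    rw [norm_mul, norm_inv, norm_norm]
    have : ‖z‖⁻¹ ≤ 1 := inv_le_one_of_one_le₀ hz1.le
    exact mul_le_of_le_one_left (norm_nonneg _) this

lemma log_kernel_lower {E : Type*} [NormedAddCommGroup E] (x y : E) :
    -Real.log (‖x‖ + 1) ≤ Real.log ((‖y‖ + 1) / ‖x - y‖) := by
  have hx := norm_nonneg x
  have hy := norm_nonneg y
  rcases (norm_nonneg (x - y)).eq_or_lt with h | h
  · rw [← h]; simp
    exact Real.log_nonneg (by linarith)
  · rw [← Real.log_inv]
    refine Real.log_le_log (by positivity) ?_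
    rw [inv_eq_one_div, div_le_div_iff₀ (by positivity) h]
    nlinarith [norm_sub_le x y]

lemma abs_log_kernel_le {E : Type*} [NormedAddCommGroup E] (x y : E) :
    |Real.log ((‖y‖ + 1) / ‖x - y‖)| ≤ (‖x‖ + 1) * (1 + ‖x - y‖⁻¹) := by
  have hx := norm_nonneg x
  have hy := norm_nonneg y
  have hlow := log_kernel_lower x y
  have h1 : Real.log (‖x‖ + 1) ≤ ‖x‖ + 1 - 1 := Real.log_le_sub_one_of_pos (by positivity)
  have h0 : 0 ≤ ‖x - y‖⁻¹ := by positivity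
  rcases (norm_nonneg (x - y)).eq_or_lt with h | h
  · rw [← h]; simp; linarith
  have h2 := Real.log_le_sub_one_of_pos (x := (‖y‖ + 1) / ‖x - y‖) (by positivity)
  have h3 : (‖y‖ + 1) / ‖x - y‖ ≤ 1 + (‖x‖ + 1) * ‖x - y‖⁻¹ := by
    rw [div_le_iff₀ h, add_mul, mul_assoc, inv_mul_cancel₀ h.ne']
    have := norm_sub_norm_le y x
    rw [norm_sub_rev] at this
    linarith
  rw [abs_le]
  constructor <;> nlinarith [mul_nonneg hx h0]

lemma integrable_log_kernel_mul (m : ℕ) (hm : 1 ≤ m) {f : EuclideanSpace ℝ (Fin (2 * m)) → ℝ}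
    (hf : Continuous f) (hi : Integrable f) (x : EuclideanSpace ℝ (Fin (2 * m))) :
    Integrable fun y => Real.log ((‖y‖ + 1) / ‖x - y‖) * f y := by
  have h1 := ((hi.add (integrable_inv_norm_mul m hm hf hi x)).norm).const_mul (‖x‖ + 1)
  refine Integrable.mono' h1 ?_ (Eventually.of_forall fun y => ?_)
  · have : Measurable fun y : EuclideanSpace ℝ (Fin (2 * m)) =>
        Real.log ((‖y‖ + 1) / ‖x - y‖) := by fun_prop
    exact (this.mul hf.measurable).aestronglyMeasurable
  · rw [norm_mul, Real.norm_eq_abs, Real.norm_eq_abs]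
    refine (mul_le_mul_of_nonneg_right (abs_log_kernel_le x y) (abs_nonneg _)).trans (le_of_eq ?_)
    have h2 : f y + ‖x - y‖⁻¹ * f y = (1 + ‖x - y‖⁻¹) * f y := by ring
    simp only [Pi.add_apply]
    rw [h2, norm_mul, Real.norm_of_nonneg (by positivity), Real.norm_eq_abs]
    ring

lemma truncated_kernel_bound (m : ℕ) {S : EuclideanSpace ℝ (Fin (2 * m)) → ℝ}
    (hS : Continuous S) (hSlog : ∀ z, 1 ≤ ‖z‖ → S z = -Real.log ‖z‖) :
    ∃ C : ℝ, 0 ≤ C ∧ ∀ z, z ≠ 0 → |-Real.log ‖z‖ - S z| ≤ C * ‖z‖⁻¹ := by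
  obtain ⟨C, hC⟩ := (isCompact_closedBall (0 : EuclideanSpace ℝ (Fin (2 * m)))
    1).exists_bound_of_continuousOn hS.continuousOn
  have hC0 : 0 ≤ C := (norm_nonneg _).trans (hC 0 (by simp))
  refine ⟨2 + C, by positivity, fun z hz => ?_⟩
  have hr : 0 < ‖z‖ := norm_pos_iff.2 hz
  rcases le_or_gt 1 ‖z‖ with h | h
  · rw [hSlog z h, sub_self, abs_zero]; positivity
  · have h1 := hC z (by simpa using h.le)
    rw [Real.norm_eq_abs] at h1
    have h2 := abs_log_le_inv_add hr.le
    have h3 : 1 ≤ ‖z‖⁻¹ := (one_le_inv₀ hr).2 h.le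
    have h4 := abs_sub (-Real.log ‖z‖) (S z)
    rw [abs_neg] at h4
    nlinarith

lemma truncated_kernel_mul (m : ℕ) (hm : 1 ≤ m) {S f : EuclideanSpace ℝ (Fin (2 * m)) → ℝ}
    (hS : Continuous S) (hSlog : ∀ z, 1 ≤ ‖z‖ → S z = -Real.log ‖z‖)
    (hf : Continuous f) (hi : Integrable f) (x : EuclideanSpace ℝ (Fin (2 * m))) :
    ∃ C : ℝ, ∀ R : ℝ, 0 < R →
      Integrable (fun y => (-Real.log ‖R⁻¹ • (x - y)‖ - S (R⁻¹ • (x - y))) * f y) ∧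
      |∫ y, (-Real.log ‖R⁻¹ • (x - y)‖ - S (R⁻¹ • (x - y))) * f y| ≤ C * R := by
  obtain ⟨C, hC0, hC⟩ := truncated_kernel_bound m hS hSlog
  have hb := (integrable_inv_norm_mul m hm hf hi x).norm
  refine ⟨C * ∫ y, ‖‖x - y‖⁻¹ * f y‖, fun R hR => ?_⟩
  have hle : ∀ᵐ y : EuclideanSpace ℝ (Fin (2 * m)),
      ‖(-Real.log ‖R⁻¹ • (x - y)‖ - S (R⁻¹ • (x - y))) * f y‖ ≤
        C * R * ‖‖x - y‖⁻¹ * f y‖ := by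
    filter_upwards [ae_ne_zero_euclidean m hm x] with y hy
    have hxy : x - y ≠ 0 := sub_ne_zero.2 hy.symm
    have h1 := hC (R⁻¹ • (x - y)) (smul_ne_zero (inv_ne_zero hR.ne') hxy)
    rw [norm_mul, Real.norm_eq_abs (-Real.log _ - _)]
    refine (mul_le_mul_of_nonneg_right h1 (norm_nonneg _)).trans (le_of_eq ?_)
    rw [norm_smul, norm_mul, norm_inv, norm_inv, norm_norm, Real.norm_of_nonneg hR.le, mul_inv,
      inv_inv]
    ring
  have hmeas : AEStronglyMeasurable
      (fun y => (-Real.log ‖R⁻¹ • (x - y)‖ - S (R⁻¹ • (x - y))) * f y) := by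
    have h1 : Measurable fun y : EuclideanSpace ℝ (Fin (2 * m)) =>
        -Real.log ‖R⁻¹ • (x - y)‖ - S (R⁻¹ • (x - y)) := by
      refine Measurable.sub (by fun_prop) (hS.measurable.comp (by fun_prop))
    exact (h1.mul hf.measurable).aestronglyMeasurable
  have hint := Integrable.mono' (hb.const_mul (C * R)) hmeas hle
  refine ⟨hint, ?_⟩
  rw [← Real.norm_eq_abs]
  refine (norm_integral_le_integral_norm _).trans ((integral_mono_ae hint.norm
    (hb.const_mul (C * R)) hle).trans (le_of_eq ?_))
  rw [integral_const_mul]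
  ring

/-! ### Second differences of the remainder -/

lemma ContDiff.second_difference_le {E : Type*} [NormedAddCommGroup E] [NormedSpace ℝ E]
    {ψ : E → ℝ} (hψ : ContDiff ℝ 2 ψ) (hc : HasCompactSupport ψ) :
    ∃ M : ℝ, 0 ≤ M ∧ ∀ z d, |ψ (z + d) + ψ (z - d) - 2 * ψ z| ≤ M * ‖d‖ ^ 2 := by
  have h1 : ContDiff ℝ 1 (fderiv ℝ ψ) := hψ.fderiv_right (by norm_num)
  obtain ⟨K, hK⟩ := h1.lipschitzWith_of_hasCompactSupport (hc.fderiv ℝ) (by norm_num)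
  refine ⟨2 * K, by positivity, fun z d => ?_⟩
  have hd : Differentiable ℝ ψ := hψ.differentiable (by norm_num)
  have hder : ∀ w ∈ closedBall (0 : E) ‖d‖, HasFDerivWithinAt (fun w => ψ (z + w) + ψ (z - w))
      (fderiv ℝ ψ (z + w) - fderiv ℝ ψ (z - w)) (closedBall 0 ‖d‖) w := by
    intro w _
    have e1 : HasFDerivAt (fun w => ψ (z + w)) (fderiv ℝ ψ (z + w)) w := by
      have := (hd (z + w)).hasFDerivAt.comp w ((hasFDerivAt_id w).const_add z)
      simpa [Function.comp_def] using this
    have e2 : HasFDerivAt (fun w => ψ (z - w)) (-fderiv ℝ ψ (z - w)) w := by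
      have := (hd (z - w)).hasFDerivAt.comp w ((hasFDerivAt_id w).const_sub z)
      simpa [Function.comp_def] using this
    have := (e1.add e2).hasFDerivWithinAt (s := closedBall 0 ‖d‖)
    rw [← sub_eq_add_neg] at this
    exact this
  have hbd : ∀ w ∈ closedBall (0 : E) ‖d‖,
      ‖fderiv ℝ ψ (z + w) - fderiv ℝ ψ (z - w)‖ ≤ 2 * K * ‖d‖ := by
    intro w hw
    have hw' : ‖w‖ ≤ ‖d‖ := by simpa using hw
    have e1 := hK.dist_le_mul (z + w) (z - w)
    rw [dist_eq_norm, dist_eq_norm] at e1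
    have e2 : z + w - (z - w) = (2 : ℝ) • w := by rw [two_smul]; abel
    rw [e2, norm_smul, Real.norm_of_nonneg (by norm_num : (0 : ℝ) ≤ 2)] at e1
    have : (0 : ℝ) ≤ K := K.2
    nlinarith
  have := (convex_closedBall (0 : E) ‖d‖).norm_image_sub_le_of_norm_hasFDerivWithin_le hder hbd
    (x := 0) (y := d) (by simp) (by simp)
  simp only [add_zero, sub_zero, Real.norm_eq_abs] at this
  have e : ψ (z + d) + ψ (z - d) - 2 * ψ z = ψ (z + d) + ψ (z - d) - (ψ z + ψ z) := by ring
  rw [e]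
  refine this.trans (le_of_eq (by ring))

lemma exists_lipschitz_log_truncation (n : ℕ) :
    ∃ S : EuclideanSpace ℝ (Fin n) → ℝ, (∀ k : ℕ, ContDiff ℝ k S) ∧
      (∀ z, 1 ≤ ‖z‖ → S z = -Real.log ‖z‖) ∧ ∃ K, LipschitzWith K S := by
  let θ : ContDiffBump (0 : EuclideanSpace ℝ (Fin n)) := ⟨1 / 2, 1, by norm_num, by norm_num⟩
  set S : EuclideanSpace ℝ (Fin n) → ℝ := fun z => (1 - θ z) * -Real.log ‖z‖ with hSdef
  have hlog : ∀ z : EuclideanSpace ℝ (Fin n), 1 ≤ ‖z‖ → S z = -Real.log ‖z‖ := by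
    intro z hz
    have : θ z = 0 := θ.zero_of_le_dist (by simpa [θ] using hz)
    simp [hSdef, this]
  have hS : ∀ k : ℕ, ContDiff ℝ k S := by
    intro k
    rw [contDiff_iff_contDiffAt]
    intro z
    rcases eq_or_ne z 0 with rfl | hz
    · have : S =ᶠ[nhds 0] fun _ => 0 := by
        filter_upwards [θ.eventuallyEq_one] with w hw
        simp [hSdef, hw]
      exact contDiffAt_const.congr_of_eventuallyEq this
    · exact (contDiffAt_const.sub θ.contDiffAt).mul
        (((contDiffAt_norm ℝ hz).log (norm_ne_zero_iff.2 hz)).neg)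
  refine ⟨S, hS, hlog, ?_⟩
  have hd : Differentiable ℝ S := (hS 1).differentiable (by norm_num)
  have hc : Continuous (fderiv ℝ S) := (hS 1).continuous_fderiv (by norm_num)
  obtain ⟨C, hC⟩ := (isCompact_closedBall (0 : EuclideanSpace ℝ (Fin n))
    1).exists_bound_of_continuousOn hc.continuousOn
  have hC0 : 0 ≤ C := (norm_nonneg _).trans (hC 0 (by simp))
  refine ⟨(C + 1).toNNReal, lipschitzWith_of_nnnorm_fderiv_le hd fun z => ?_⟩
  rw [← NNReal.coe_le_coe, coe_nnnorm, Real.coe_toNNReal _ (by positivity)]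
  rcases le_or_gt ‖z‖ 1 with h | h
  · exact (hC z (by simpa using h)).trans (by linarith)
  · have hev : S =ᶠ[nhds z] fun w => -Real.log ‖w‖ := by
      have : ∀ᶠ w in nhds z, 1 < ‖w‖ :=
        (continuous_norm.tendsto z).eventually (eventually_gt_nhds h)
      filter_upwards [this] with w hw using hlog w hw.le
    have hz : z ≠ 0 := norm_pos_iff.1 (by linarith)
    have hdn : DifferentiableAt ℝ (fun w : EuclideanSpace ℝ (Fin n) => ‖w‖) z :=
      (contDiffAt_norm ℝ hz (n := 1)).differentiableAt (by norm_num)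
    rw [hev.fderiv_eq, fderiv_fun_neg, norm_neg, fderiv.log hdn (norm_ne_zero_iff.2 hz), norm_smul,
      norm_inv, norm_norm]
    have h1 : ‖fderiv ℝ (fun w : EuclideanSpace ℝ (Fin n) => ‖w‖) z‖ ≤ (1 : NNReal) :=
      norm_fderiv_le_of_lipschitz ℝ lipschitzWith_one_norm
    have h2 : ‖z‖⁻¹ ≤ 1 := inv_le_one_of_one_le₀ h.le
    have h3 : ‖z‖⁻¹ * ‖fderiv ℝ (fun w : EuclideanSpace ℝ (Fin n) => ‖w‖) z‖ ≤ 1 * 1 :=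
      mul_le_mul h2 (by simpa using h1) (norm_nonneg _) zero_le_one
    linarith

/-- The averages `∫ ψ z * u (x - R z)` have second differences tending to zero as `R → ∞`, provided
the mass of `|u|` on `ball 0 R` is `o(R ^ (2 * m + 2))`. -/
lemma tendsto_second_difference_average (m : ℕ) {u ψ : EuclideanSpace ℝ (Fin (2 * m)) → ℝ}
    (hu : Continuous u) (hψ : ContDiff ℝ 2 ψ) (hψ0 : ∀ z, 2 ≤ ‖z‖ → ψ z = 0)
    (hG : Tendsto (fun R : ℝ => (R ^ (2 * m + 2))⁻¹ * ∫ y in ball 0 R, |u y|) atTop (nhds 0))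
    (x d : EuclideanSpace ℝ (Fin (2 * m))) :
    Tendsto (fun R : ℝ => (∫ z, ψ z * u (x + d + (-R) • z)) + (∫ z, ψ z * u (x - d + (-R) • z)) -
      2 * ∫ z, ψ z * u (x + (-R) • z)) atTop (nhds 0) := by
  have hc : HasCompactSupport ψ := HasCompactSupport.intro
    (isCompact_closedBall (0 : EuclideanSpace ℝ (Fin (2 * m))) 2) fun z hz => hψ0 z (by
      simp at hz; exact hz.le)
  obtain ⟨M, hM0, hM⟩ := hψ.second_difference_le hc
  have hcv : ∀ (x : EuclideanSpace ℝ (Fin (2 * m))) (R : ℝ), 0 < R →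
      ∫ z, ψ z * u (x + (-R) • z) = (R ^ (2 * m))⁻¹ * ∫ y, ψ (R⁻¹ • (x - y)) * u y := by
    intro x R hR
    rw [← integral_comp_add_neg_smul m (fun y => ψ (R⁻¹ • (x - y)) * u y) x hR]
    congr 1
    ext z
    have e1 : R⁻¹ • (x - (x + (-R) • z)) = z := by
      rw [sub_add_cancel_left, neg_smul, neg_neg, smul_smul, inv_mul_cancel₀ hR.ne', one_smul]
    rw [e1]
  have hint : ∀ (x : EuclideanSpace ℝ (Fin (2 * m))) (R : ℝ), 0 < R →
      Integrable fun y => ψ (R⁻¹ • (x - y)) * u y := by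
    intro x R hR
    refine Continuous.integrable_of_hasCompactSupport ?_ ?_
    · exact (hψ.continuous.comp (by fun_prop)).mul hu
    · refine HasCompactSupport.mul_right (HasCompactSupport.intro
        (isCompact_closedBall x (2 * R)) fun y hy => hψ0 _ ?_)
      rw [mem_closedBall, dist_eq_norm, norm_sub_rev, not_le] at hy
      rw [norm_smul, norm_inv, Real.norm_of_nonneg hR.le, ← div_eq_inv_mul, le_div_iff₀ hR]
      exact hy.le
  have hlim : Tendsto (fun R : ℝ => (M * ‖d‖ ^ 2 * 4 ^ (2 * m + 2)) *
      (((4 * R) ^ (2 * m + 2))⁻¹ * ∫ y in ball 0 (4 * R), |u y|)) atTop (nhds 0) := by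
    have := (hG.comp (tendsto_id.const_mul_atTop (by norm_num : (0 : ℝ) < 4))).const_mul
      (M * ‖d‖ ^ 2 * 4 ^ (2 * m + 2))
    simpa [Function.comp_def] using this
  refine squeeze_zero_norm' ?_ hlim
  filter_upwards [eventually_gt_atTop (‖x‖ + ‖d‖)] with R hRx
  have hR : 0 < R := lt_of_le_of_lt (by positivity) hRx
  rw [hcv _ R hR, hcv _ R hR, hcv _ R hR]
  have e : (R ^ (2 * m))⁻¹ * (∫ y, ψ (R⁻¹ • (x + d - y)) * u y) +
      (R ^ (2 * m))⁻¹ * (∫ y, ψ (R⁻¹ • (x - d - y)) * u y) -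
      2 * ((R ^ (2 * m))⁻¹ * ∫ y, ψ (R⁻¹ • (x - y)) * u y) =
      (R ^ (2 * m))⁻¹ * ∫ y, ((ψ (R⁻¹ • (x + d - y)) * u y + ψ (R⁻¹ • (x - d - y)) * u y) -
        2 * (ψ (R⁻¹ • (x - y)) * u y)) := by
    have hsum : Integrable fun y => ψ (R⁻¹ • (x + d - y)) * u y + ψ (R⁻¹ • (x - d - y)) * u y :=
      (hint _ R hR).add (hint _ R hR)
    rw [integral_sub hsum ((hint _ R hR).const_mul 2),
      integral_add (hint _ R hR) (hint _ R hR), integral_const_mul]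
    ring
  rw [e, norm_mul, norm_inv, norm_pow, Real.norm_of_nonneg hR.le]
  have hub : IntegrableOn (fun y => |u y|) (ball 0 (4 * R)) :=
    (hu.abs.continuousOn.integrableOn_compact (isCompact_closedBall 0 (4 * R))).mono_set
      ball_subset_closedBall
  have hbound : ‖∫ y, ((ψ (R⁻¹ • (x + d - y)) * u y + ψ (R⁻¹ • (x - d - y)) * u y) -
        2 * (ψ (R⁻¹ • (x - y)) * u y))‖ ≤
      ∫ y, (ball 0 (4 * R)).indicator (fun y => M * ‖d‖ ^ 2 * (R ^ 2)⁻¹ * |u y|) y := by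
    refine norm_integral_le_of_norm_le
      ((integrable_indicator_iff measurableSet_ball).2 (hub.const_mul _))
      (Eventually.of_forall fun y => ?_)
    by_cases hy : y ∈ ball (0 : EuclideanSpace ℝ (Fin (2 * m))) (4 * R)
    · rw [Set.indicator_of_mem hy]
      have e2 : ψ (R⁻¹ • (x + d - y)) * u y + ψ (R⁻¹ • (x - d - y)) * u y -
          2 * (ψ (R⁻¹ • (x - y)) * u y) = (ψ (R⁻¹ • (x - y) + R⁻¹ • d) +
            ψ (R⁻¹ • (x - y) - R⁻¹ • d) - 2 * ψ (R⁻¹ • (x - y))) * u y := by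
        rw [← smul_add, ← smul_sub, sub_add_eq_add_sub, sub_right_comm]
        ring
      rw [e2, norm_mul, Real.norm_eq_abs, Real.norm_eq_abs]
      refine mul_le_mul_of_nonneg_right ((hM _ _).trans (le_of_eq ?_)) (abs_nonneg _)
      rw [norm_smul, norm_inv, Real.norm_of_nonneg hR.le]
      ring
    · rw [Set.indicator_of_notMem hy]
      have hy' : 4 * R ≤ ‖y‖ := by simpa using hy
      have hz : ∀ w : EuclideanSpace ℝ (Fin (2 * m)), ‖w‖ ≤ ‖x‖ + ‖d‖ →
          ψ (R⁻¹ • (w - y)) = 0 := by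
        intro w hw
        apply hψ0
        rw [norm_smul, norm_inv, Real.norm_of_nonneg hR.le, ← div_eq_inv_mul, le_div_iff₀ hR]
        have := norm_sub_norm_le y w
        rw [norm_sub_rev] at this
        linarith
      rw [hz _ (norm_add_le _ _), hz _ (norm_sub_le _ _), hz x (by linarith [norm_nonneg d])]
      simp
  refine (mul_le_mul_of_nonneg_left hbound (by positivity)).trans (le_of_eq ?_)
  rw [integral_indicator measurableSet_ball, integral_const_mul, mul_pow, pow_add R]
  field_simp

/-! ### The difference between the solution and its potential is affine -/

lemma potential_remainder_second_difference (m : ℕ) (hm : 1 ≤ m)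
    {u f : EuclideanSpace ℝ (Fin (2 * m)) → ℝ} (hu : ContDiff ℝ (2 * m : ℕ) u)
    (hfu : negLapIter (2 * m) m u = f) (hi : Integrable f)
    (hG : Tendsto (fun R : ℝ => (R ^ (2 * m + 2))⁻¹ * ∫ y in ball 0 R, |u y|) atTop (nhds 0))
    {H : EuclideanSpace ℝ (Fin (2 * m)) → ℝ}
    (hH : ∀ x, H x = betaNFact (2 * m) * u x - ∫ y, Real.log ((‖y‖ + 1) / ‖x - y‖) * f y)
    (x d : EuclideanSpace ℝ (Fin (2 * m))) : H (x + d) + H (x - d) = 2 * H x := by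
  have hf : Continuous f := hfu ▸ (ContDiff.negLapIter m 0 (by simpa using hu)).continuous
  obtain ⟨S, hS, hSlog, K, hK⟩ := exists_lipschitz_log_truncation (2 * m)
  let χ : ContDiffBump (0 : EuclideanSpace ℝ (Fin (2 * m))) := ⟨1, 2, by norm_num, by norm_num⟩
  set ψ : EuclideanSpace ℝ (Fin (2 * m)) → ℝ := fun z => negLapIter (2 * m) m S z * χ z with hψdef
  have hψ : ContDiff ℝ 2 ψ :=
    (ContDiff.negLapIter m 2 (hS _)).mul χ.contDiff
  have hψ0 : ∀ z, 2 ≤ ‖z‖ → ψ z = 0 := fun z hz => by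
    have : χ z = 0 := χ.zero_of_le_dist (by simpa [χ] using hz)
    simp [hψdef, this]
  have hχ1 : ∀ z, ‖z‖ < 1 → χ z = 1 := fun z hz =>
    χ.one_of_mem_closedBall (by simpa [χ] using hz.le)
  have hc := tendsto_second_difference_average m hu.continuous hψ hψ0 hG x d
  set C : ℝ → EuclideanSpace ℝ (Fin (2 * m)) → ℝ := fun R x => ∫ z, ψ z * u (x + (-R) • z)
  set k : ℝ → EuclideanSpace ℝ (Fin (2 * m)) → EuclideanSpace ℝ (Fin (2 * m)) → ℝ :=
    fun R x y => (Real.log R - Real.log (‖y‖ + 1) - S (R⁻¹ • (x - y))) * f y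
  have hdec : ∀ R : ℝ, 0 < R → ∀ x, Integrable (k R x) ∧ H x = (∫ y, k R x y) + C R x := by
    intro R hR x
    obtain ⟨B, hB⟩ := truncated_kernel_mul m hm (hS 0).continuous hSlog hf hi x
    have hG := (hB R hR).1
    have hl := integrable_log_kernel_mul m hm hf hi x
    have hrep := truncated_representation m hm hu (hS _) hSlog χ.contDiff χ.hasCompactSupport hχ1
      x hR
    rw [hfu] at hrep
    have hae : (fun y => (-Real.log ‖R⁻¹ • (x - y)‖ - S (R⁻¹ • (x - y))) * f y -
        Real.log ((‖y‖ + 1) / ‖x - y‖) * f y) =ᵐ[volume] k R x := by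
      filter_upwards [ae_ne_zero_euclidean m hm x] with y hy
      have hxy : ‖x - y‖ ≠ 0 := norm_ne_zero_iff.2 (sub_ne_zero.2 hy.symm)
      simp only [k]
      rw [norm_smul, norm_inv, Real.norm_of_nonneg hR.le, Real.log_mul (by positivity) hxy,
        Real.log_inv, Real.log_div (by positivity) hxy]
      ring
    refine ⟨(hG.sub hl).congr hae, ?_⟩
    rw [hH, hrep, ← integral_congr_ae hae, integral_sub hG hl]
    simp only [C, hψdef]
    ring
  have hk : ∀ R : ℝ, 0 < R → ∀ w e, ‖e‖ = ‖d‖ →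
      |(∫ y, k R (w + e) y) - ∫ y, k R w y| ≤ K * ‖d‖ * (∫ y, |f y|) * R⁻¹ := by
    intro R hR w e he
    rw [← integral_sub (hdec R hR _).1 (hdec R hR _).1, ← Real.norm_eq_abs]
    refine (norm_integral_le_of_norm_le (hi.abs.const_mul (K * ‖d‖ * R⁻¹))
      (Eventually.of_forall fun y => ?_)).trans (le_of_eq ?_)
    · have e1 : k R (w + e) y - k R w y =
          (S (R⁻¹ • (w - y)) - S (R⁻¹ • (w + e - y))) * f y := by
        simp only [k]; ring
      rw [e1, norm_mul, ← Real.norm_eq_abs, ← dist_eq_norm]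
      refine mul_le_mul_of_nonneg_right ((hK.dist_le_mul _ _).trans (le_of_eq ?_)) (norm_nonneg _)
      rw [dist_eq_norm, ← smul_sub, norm_smul, norm_inv, Real.norm_of_nonneg hR.le]
      have e2 : w - y - (w + e - y) = -e := by abel
      rw [e2, norm_neg, he]
      ring
    · rw [integral_const_mul]; ring
  have hk0 : Tendsto (fun R : ℝ => K * ‖d‖ * (∫ y, |f y|) * R⁻¹) atTop (nhds 0) := by
    simpa using tendsto_inv_atTop_zero.const_mul (K * ‖d‖ * (∫ y, |f y|))
  have hk1 : Tendsto (fun R : ℝ => (∫ y, k R (x + d) y) - ∫ y, k R x y) atTop (nhds 0) :=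
    squeeze_zero_norm' ((eventually_gt_atTop 0).mono fun R hR => hk R hR x d rfl) hk0
  have hk2 : Tendsto (fun R : ℝ => (∫ y, k R (x - d) y) - ∫ y, k R x y) atTop (nhds 0) :=
    squeeze_zero_norm' ((eventually_gt_atTop 0).mono fun R hR => by
      have := hk R hR x (-d) (norm_neg d)
      rwa [← sub_eq_add_neg] at this) hk0
  have htot := (hk1.add hk2).add hc
  have hconst : Tendsto (fun _ : ℝ => H (x + d) + H (x - d) - 2 * H x) atTop
      (nhds (0 + 0 + 0)) := by
    refine htot.congr' ((eventually_gt_atTop 0).mono fun R hR => ?_)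
    rw [(hdec R hR (x + d)).2, (hdec R hR (x - d)).2, (hdec R hR x).2]
    ring
  have := tendsto_nhds_unique hconst tendsto_const_nhds
  linarith

/-- A midpoint-affine function controlled from above by a continuous `u` with `exp (a * u)`
integrable, up to a logarithm, is constant. -/
lemma constant_of_midpoint_affine {E : Type*} [NormedAddCommGroup E] [NormedSpace ℝ E]
    [FiniteDimensional ℝ E] [MeasurableSpace E] [BorelSpace E] (ν : Measure E)
    [ν.IsAddHaarMeasure] {u H : E → ℝ} (hu : Continuous u) {a b F : ℝ} (ha : 0 < a) (hb : 0 < b)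
    (hF : 0 ≤ F) (hint : Integrable (fun x => Real.exp (a * u x)) ν)
    (hmid : ∀ x d, H (x + d) + H (x - d) = 2 * H x)
    (hup : ∀ x, H x ≤ b * u x + F * Real.log (‖x‖ + 1)) (x : E) : H x = H 0 := by
  have hadd : ∀ p q, H (p + q) - H 0 = (H p - H 0) + (H q - H 0) := by
    intro p q
    have h1 := hmid ((1 / 2 : ℝ) • (p + q)) ((1 / 2 : ℝ) • (p - q))
    have h2 := hmid ((1 / 2 : ℝ) • (p + q)) ((1 / 2 : ℝ) • (p + q))
    rw [← smul_add, ← smul_sub, add_add_sub_cancel, add_sub_sub_cancel, ← two_smul ℝ p,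
      ← two_smul ℝ q, smul_smul, smul_smul] at h1
    rw [← smul_add, sub_self, ← two_smul ℝ (p + q), smul_smul] at h2
    norm_num at h1 h2
    linarith
  let g : E →+ ℝ := AddMonoidHom.mk' (fun x => H x - H 0) hadd
  have hg : ∀ x, g x = H x - H 0 := fun x => rfl
  obtain ⟨B, hB⟩ := (isCompact_closedBall (0 : E) 1).exists_bound_of_continuousOn hu.continuousOn
  set M : ℝ := b * B + F * Real.log 2 - H 0
  have hgM : ∀ w : E, ‖w‖ ≤ 1 → g w ≤ M := by
    intro w hw
    have h1 := hB w (by simpa using hw)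
    have h2 : Real.log (‖w‖ + 1) ≤ Real.log 2 :=
      Real.log_le_log (by positivity) (by linarith)
    have h3 := (le_abs_self _).trans h1
    rw [hg]
    have := hup w
    have := mul_le_mul_of_nonneg_left h3 hb.le
    have := mul_le_mul_of_nonneg_left h2 hF
    simp only [M]
    linarith
  have hgM' : ∀ w : E, ‖w‖ ≤ 1 → -M ≤ g w := by
    intro w hw
    have := hgM (-w) (by simpa using hw)
    rw [map_neg] at this
    linarith
  suffices h : ∀ x0, g x0 ≤ 0 by
    have h1 := h x
    have h2 := h (-x)
    rw [map_neg] at h2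
    rw [hg] at h1 h2
    linarith
  intro x0
  by_contra! hpos
  set ε : ℝ := g x0 / (2 * (F * ‖x0‖ + 1)) with hε
  have hεpos : 0 < ε := by positivity
  have hεle : F * (ε * ‖x0‖) ≤ g x0 / 2 := by
    have : ε * (F * ‖x0‖ + 1) = g x0 / 2 := by rw [hε]; field_simp
    nlinarith
  set D : ℝ := H 0 - M - F * (2 * ε - 1 - Real.log ε)
  have hlow : ∀ (k : ℕ) (y : E), y ∈ ball ((k : ℝ) • x0) 1 →
      a * ((k * (g x0 / 2) + D) / b) ≤ Real.exp (a * u y) := by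
    intro k y hy
    set w := y - (k : ℝ) • x0
    have hw : ‖w‖ ≤ 1 := (by simpa [w, dist_eq_norm] using hy : ‖w‖ < 1).le
    have hyw : y = k • x0 + w := by simp [w, Nat.cast_smul_eq_nsmul]
    have h1 : g y = k * g x0 + g w := by rw [hyw, map_add, map_nsmul, nsmul_eq_mul]
    have h2 := hgM' w hw
    have h3 := hup y
    have h4 : ‖y‖ + 1 ≤ k * ‖x0‖ + 2 := by
      rw [hyw]
      have := norm_add_le (k • x0) w
      rw [← Nat.cast_smul_eq_nsmul ℝ, norm_smul, Real.norm_of_nonneg (Nat.cast_nonneg _)] at this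
      rw [← Nat.cast_smul_eq_nsmul ℝ]
      linarith
    have h5 := Real.log_le_sub_one_of_pos (x := ε * (‖y‖ + 1)) (by positivity)
    rw [Real.log_mul hεpos.ne' (by positivity)] at h5
    have h6 : Real.log (‖y‖ + 1) ≤ k * (ε * ‖x0‖) + (2 * ε - 1 - Real.log ε) := by
      nlinarith [mul_le_mul_of_nonneg_left h4 hεpos.le]
    have h7 := mul_le_mul_of_nonneg_left h6 hF
    have h8 : (k : ℝ) * (F * (ε * ‖x0‖)) ≤ k * (g x0 / 2) :=
      mul_le_mul_of_nonneg_left hεle (Nat.cast_nonneg _)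
    have h9 : (k * (g x0 / 2) + D) / b ≤ u y := by
      rw [div_le_iff₀ hb]
      rw [hg y] at h1
      simp only [D]
      nlinarith
    have := mul_le_mul_of_nonneg_left h9 ha.le
    linarith [Real.add_one_le_exp (a * u y)]
  set I := ∫ x, Real.exp (a * u x) ∂ν
  set vol := ν.real (ball (0 : E) 1)
  have hvol : 0 < vol :=
    ENNReal.toReal_pos (measure_ball_pos ν 0 one_pos).ne' measure_ball_lt_top.ne
  have hI : ∀ k : ℕ, a * ((k * (g x0 / 2) + D) / b) * vol ≤ I := by
    intro k
    have h1 := setIntegral_ge_of_const_le (μ := ν) (measurableSet_ball)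
      measure_ball_lt_top.ne (hlow k) hint.integrableOn
    have h2 : ν.real (ball ((k : ℝ) • x0) 1) = vol := by
      simp only [vol, Measure.real, Measure.addHaar_ball_center ν ((k : ℝ) • x0) 1]
    have h3 := setIntegral_le_integral (s := ball ((k : ℝ) • x0) 1) hint
      (Eventually.of_forall fun x => (Real.exp_pos _).le)
    have h1' : a * ((k * (g x0 / 2) + D) / b) * ν.real (ball ((k : ℝ) • x0) 1) ≤
      ∫ x in ball ((k : ℝ) • x0) 1, Real.exp (a * u x) ∂ν := by simpa [mul_comm] using h1
    rw [h2] at h1'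
    exact h1'.trans h3
  obtain ⟨k, hk⟩ := exists_nat_gt ((I / vol * b / a - D) / (g x0 / 2))
  rw [div_lt_iff₀ (by positivity)] at hk
  have h1 := hI k
  rw [← le_div_iff₀ hvol, mul_div_assoc', div_le_iff₀ hb, ← le_div_iff₀' ha] at h1
  linarith

lemma tendsto_mass_of_isLittleO (m : ℕ) {u : EuclideanSpace ℝ (Fin (2 * m)) → ℝ}
    (hu : Continuous u)
    (hgr : ∀ ε > (0 : ℝ), ∃ R : ℝ, ∀ x, R ≤ ‖x‖ → |u x| ≤ ε * ‖x‖ ^ 2) :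
    Tendsto (fun R : ℝ => (R ^ (2 * m + 2))⁻¹ * ∫ y in ball 0 R, |u y|) atTop (nhds 0) := by
  set ω := volume.real (ball (0 : EuclideanSpace ℝ (Fin (2 * m))) 1)
  have hω : 0 ≤ ω := measureReal_nonneg
  rw [Metric.tendsto_nhds]
  intro δ hδ
  obtain ⟨R0, hR0⟩ := hgr (δ / (2 * (ω + 1))) (by positivity)
  set ε := δ / (2 * (ω + 1)) with hε
  have hεpos : 0 < ε := by positivity
  have hεω : ε * ω < δ / 2 := by
    have : ε * (ω + 1) = δ / 2 := by rw [hε]; field_simp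
    nlinarith
  obtain ⟨B, hB⟩ := (isCompact_closedBall (0 : EuclideanSpace ℝ (Fin (2 * m)))
    R0).exists_bound_of_continuousOn hu.continuousOn
  have hbd : ∀ y, |u y| ≤ |B| + ε * ‖y‖ ^ 2 := by
    intro y
    rcases le_total R0 ‖y‖ with h | h
    · linarith [hR0 y h, abs_nonneg B]
    · have := (hB y (by simpa using h)).trans (le_abs_self B)
      rw [Real.norm_eq_abs] at this
      have : 0 ≤ ε * ‖y‖ ^ 2 := by positivity
      linarith
  have hlim : Tendsto (fun R : ℝ => |B| * ω * (R ^ 2)⁻¹) atTop (nhds 0) := by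
    have : Tendsto (fun R : ℝ => (R ^ 2)⁻¹) atTop (nhds 0) :=
      (tendsto_pow_atTop (by norm_num)).inv_tendsto_atTop
    simpa using this.const_mul (|B| * ω)
  filter_upwards [hlim.eventually (eventually_lt_nhds (half_pos hδ)), eventually_gt_atTop 0]
    with R hR hRpos
  have h0 : 0 ≤ ∫ y in ball (0 : EuclideanSpace ℝ (Fin (2 * m))) R, |u y| :=
    integral_nonneg fun _ => abs_nonneg _
  rw [Real.dist_0_eq_abs, abs_of_nonneg (by positivity)]
  have hvolR : volume.real (ball (0 : EuclideanSpace ℝ (Fin (2 * m))) R) = R ^ (2 * m) * ω := by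
    have := Measure.addHaar_ball_of_pos (volume : Measure (EuclideanSpace ℝ (Fin (2 * m)))) 0 hRpos
    simp only [Measure.real, this, ω, ENNReal.toReal_mul]
    rw [ENNReal.toReal_ofReal (by positivity)]
    simp
  have h1 := norm_setIntegral_le_of_norm_le_const (μ := volume)
    (s := ball (0 : EuclideanSpace ℝ (Fin (2 * m))) R)
    (f := fun y => |u y|) (C := |B| + ε * R ^ 2) measure_ball_lt_top fun y hy => by
      have hy' : ‖y‖ < R := by simpa using hy
      rw [Real.norm_eq_abs, abs_abs]
      refine (hbd y).trans ?_
      gcongr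
  rw [Real.norm_of_nonneg h0, hvolR] at h1
  have h2 : (R ^ (2 * m + 2))⁻¹ * ((|B| + ε * R ^ 2) * (R ^ (2 * m) * ω)) =
      |B| * ω * (R ^ 2)⁻¹ + ε * ω := by
    rw [pow_add]
    field_simp
  have h3 := mul_le_mul_of_nonneg_left h1 (by positivity : 0 ≤ (R ^ (2 * m + 2))⁻¹)
  linarith

/-! ### Growth in dimension two -/

lemma hasDerivAt_ite_le {f g f' g' : ℝ → ℝ} {c : ℝ} (hf : ∀ s ≤ c, HasDerivAt f (f' s) s)
    (hg : ∀ s, c ≤ s → HasDerivAt g (g' s) s) (h : f c = g c) (h' : f' c = g' c) (s : ℝ) :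
    HasDerivAt (fun s => if s ≤ c then f s else g s) (if s ≤ c then f' s else g' s) s := by
  rcases lt_trichotomy s c with hs | rfl | hs
  · rw [if_pos hs.le]
    refine (hf s hs.le).congr_of_eventuallyEq ?_
    filter_upwards [eventually_lt_nhds hs] with t ht
    rw [if_pos ht.le]
  · rw [if_pos le_rfl]
    have h1 : HasDerivWithinAt (fun t => if t ≤ s then f t else g t) (f' s) (Set.Iic s) s :=
      (hf s le_rfl).hasDerivWithinAt.congr (fun t ht => if_pos ht) (if_pos le_rfl)
    have h2 : HasDerivWithinAt (fun t => if t ≤ s then f t else g t) (f' s) (Set.Ici s) s := by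
      rw [h']
      refine (hg s le_rfl).hasDerivWithinAt.congr (fun t ht => ?_) (by simp [h])
      rcases (Set.mem_Ici.1 ht).eq_or_lt with rfl | ht'
      · simp [h]
      · rw [if_neg (not_le.2 ht')]
    have := h1.union h2
    rwa [Set.Iic_union_Ici, hasDerivWithinAt_univ] at this
  · rw [if_neg (not_le.2 hs)]
    refine (hg s hs.le).congr_of_eventuallyEq ?_
    filter_upwards [eventually_gt_nhds hs] with t ht
    rw [if_neg (not_le.2 ht)]

/-- In the plane, `-log ‖z‖` has a `C²` superharmonic truncation. -/
lemma exists_superharmonic_log_truncation :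
    ∃ S : EuclideanSpace ℝ (Fin (2 * 1)) → ℝ, ContDiff ℝ (2 * 1 : ℕ) S ∧
      (∀ z, 1 ≤ ‖z‖ → S z = -Real.log ‖z‖) ∧
      ∀ z, negLapIter (2 * 1) 1 S z = if ‖z‖ ^ 2 ≤ 1 then 4 * (1 - ‖z‖ ^ 2) else 0 := by
  set T : ℝ → ℝ := fun s => if s ≤ 1 then -(1 / 2) * (2 * s - s ^ 2 / 2 - 3 / 2)
    else -(1 / 2) * Real.log s with hT
  set T1 : ℝ → ℝ := fun s => if s ≤ 1 then -(1 / 2) * (2 - s) else -(1 / 2) * s⁻¹ with hT1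
  set T2 : ℝ → ℝ := fun s => if s ≤ 1 then 1 / 2 else 1 / 2 * (s ^ 2)⁻¹ with hT2
  have hd1 : ∀ s, HasDerivAt T (T1 s) s := by
    refine hasDerivAt_ite_le (fun s _ => ?_) (fun s hs => ?_) (by norm_num) (by norm_num)
    · have := ((((hasDerivAt_id s).const_mul 2).sub (((hasDerivAt_id s).pow 2).div_const 2)).sub_const
        (3 / 2)).const_mul (-(1 / 2))
      exact this.congr_deriv (by simp)
    · exact (Real.hasDerivAt_log (by linarith)).const_mul _
  have hd2 : ∀ s, HasDerivAt T1 (T2 s) s := by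
    refine hasDerivAt_ite_le (fun s _ => ?_) (fun s hs => ?_) (by norm_num) (by norm_num)
    · have := ((hasDerivAt_id s).const_sub 2).const_mul (-(1 / 2))
      exact this.congr_deriv (by norm_num)
    · have := (hasDerivAt_inv (by linarith : s ≠ 0)).const_mul (-(1 / 2))
      exact this.congr_deriv (by ring)
  have hc2 : Continuous T2 := by
    have : T2 = fun s => 1 / 2 * ((max s 1) ^ 2)⁻¹ := by
      ext s
      rcases le_or_gt s 1 with h | h
      · simp [hT2, h]
      · simp [hT2, not_le.2 h, max_eq_left h.le]
    rw [this]
    refine continuous_const.mul (Continuous.inv₀ (by fun_prop) fun s => ?_)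
    have : 0 < max s 1 := lt_max_of_lt_right one_pos
    positivity
  have hT1C : ContDiff ℝ 1 T1 := by
    rw [contDiff_one_iff_deriv]
    refine ⟨fun s => (hd2 s).differentiableAt, ?_⟩
    rwa [funext fun s => (hd2 s).deriv]
  have hTC : ContDiff ℝ (1 + 1) T := by
    rw [contDiff_succ_iff_deriv]
    refine ⟨fun s => (hd1 s).differentiableAt, by simp, ?_⟩
    rwa [funext fun s => (hd1 s).deriv]
  refine ⟨fun z => T (‖z‖ ^ 2), ?_, fun z hz => ?_, fun z => ?_⟩
  · have h2 : ContDiff ℝ (2 : ℕ) T := by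
      convert hTC using 1
      norm_num
    exact h2.comp (contDiff_norm_sq ℝ)
  · rcases hz.eq_or_lt with h | h
    · simp only [hT, ← h]; norm_num
    · have : ¬ ‖z‖ ^ 2 ≤ 1 := by nlinarith
      simp only [hT, if_neg this, Real.log_pow]
      push_cast; ring
  · rw [negLapIter_succ, negLapIter_zero]
    simp only
    rw [lap_comp_norm_sq (2 * 1) (fun s _ => hd1 s) (fun s _ => hd2 s)]
    by_cases h : ‖z‖ ^ 2 ≤ 1
    · simp only [hT1, hT2, if_pos h]; push_cast; ring
    · have h0 : ‖z‖ ^ 2 ≠ 0 := by intro h'; rw [h'] at h; norm_num at h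
      simp only [hT1, hT2, if_neg h]; push_cast
      field_simp
      ring

lemma tendsto_mass_of_integrable_exp {u : EuclideanSpace ℝ (Fin (2 * 1)) → ℝ}
    (hu : ContDiff ℝ (2 * 1 : ℕ) u) (hi : Integrable (negLapIter (2 * 1) 1 u)) {a : ℝ}
    (ha : 0 < a) (hint : Integrable fun y => Real.exp (a * u y)) :
    Tendsto (fun R : ℝ => (R ^ (2 * 1 + 2))⁻¹ * ∫ y in ball 0 R, |u y|) atTop (nhds 0) := by
  obtain ⟨S, hS, hSlog, hSp⟩ := exists_superharmonic_log_truncation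
  let χ : ContDiffBump (0 : EuclideanSpace ℝ (Fin (2 * 1))) := ⟨1, 2, by norm_num, by norm_num⟩
  have hχ1 : ∀ z, ‖z‖ ≤ 1 → χ z = 1 := fun z hz =>
    χ.one_of_mem_closedBall (by simpa [χ] using hz)
  have hf : Continuous (negLapIter (2 * 1) 1 u) :=
    (ContDiff.negLapIter 1 0 (by simpa using hu)).continuous
  set p := negLapIter (2 * 1) 1 S with hp
  have hpcont : Continuous p := (ContDiff.negLapIter 1 0 (by simpa using hS)).continuous
  have hp0 : ∀ z, 1 ≤ ‖z‖ → p z = 0 := by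
    intro z hz
    rw [hSp]
    split_ifs with h
    · have : ‖z‖ = 1 := by nlinarith
      rw [this]; norm_num
    · rfl
  have hppos : ∀ z, 0 ≤ p z ∧ p z ≤ 4 := by
    intro z
    rw [hSp]
    split_ifs with h
    · constructor <;> nlinarith [sq_nonneg ‖z‖]
    · norm_num
  have hp3 : ∀ z, ‖z‖ < 1 / 2 → 3 ≤ p z := by
    intro z hz
    rw [hSp, if_pos (by nlinarith [norm_nonneg z])]
    nlinarith [norm_nonneg z]
  have hpχ : ∀ z, p z * χ z = p z := by
    intro z
    rcases le_or_gt ‖z‖ 1 with h | h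
    · rw [hχ1 z h, mul_one]
    · rw [hp0 z h.le, zero_mul]
  have hpc : HasCompactSupport p := HasCompactSupport.intro
    (isCompact_closedBall (0 : EuclideanSpace ℝ (Fin (2 * 1))) 1) fun z hz => hp0 z (by
      simp at hz; exact hz.le)
  obtain ⟨C, hC⟩ := truncated_kernel_mul 1 le_rfl hS.continuous hSlog hf hi 0
  set I := ∫ y, Real.exp (a * u y)
  set b := betaNFact (2 * 1)
  have key : ∀ R : ℝ, 0 < R → 3 * ((R ^ (2 * 1))⁻¹ * ∫ y in ball 0 (R / 2), |u y|) ≤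
      8 / a * ((R ^ (2 * 1))⁻¹ * I) + (|b * u 0| + C * R) := by
    intro R hR
    have hrep := truncated_representation 1 le_rfl hu hS hSlog χ.contDiff χ.hasCompactSupport
      (fun z hz => hχ1 z hz.le) 0 hR
    have hCR := (hC R hR).2
    have hsm := fun F => integral_comp_add_neg_smul 1 F 0 hR
    simp only [← hp, hpχ, zero_add] at hrep hsm
    have hcu : Continuous fun z : EuclideanSpace ℝ (Fin (2 * 1)) => u ((-R) • z) :=
      hu.continuous.comp (by fun_prop)
    have hi1 : Integrable fun z => p z * u ((-R) • z) :=
      (hpcont.mul hcu).integrable_of_hasCompactSupport hpc.mul_right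
    have hi3 : Integrable fun z : EuclideanSpace ℝ (Fin (2 * 1)) =>
        Real.exp (a * u ((-R) • z)) := hint.comp_smul (neg_ne_zero.2 hR.ne')
    have hiu : Integrable ((ball (0 : EuclideanSpace ℝ (Fin (2 * 1))) (R / 2)).indicator
        fun y => |u y|) :=
      (integrable_indicator_iff measurableSet_ball).2
        ((hu.continuous.abs.continuousOn.integrableOn_compact
          (isCompact_closedBall 0 (R / 2))).mono_set ball_subset_closedBall)
    rw [← integral_indicator measurableSet_ball, ← hsm, ← hsm, ← integral_const_mul,
      ← integral_const_mul]
    have hle : ∫ z, 3 * (ball (0 : EuclideanSpace ℝ (Fin (2 * 1))) (R / 2)).indicator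
        (fun y => |u y|) ((-R) • z) ≤
        ∫ z, (8 / a * Real.exp (a * u ((-R) • z)) - p z * u ((-R) • z)) := by
      refine integral_mono ((hiu.comp_smul (neg_ne_zero.2 hR.ne')).const_mul 3)
        ((hi3.const_mul _).sub hi1) fun z => ?_
      set v := u ((-R) • z) with hv
      have h1 : p z * |v| ≤ 8 / a * Real.exp (a * v) - p z * v := by
        have h2 : |v| + v ≤ 2 / a * Real.exp (a * v) := by
          rcases le_total 0 v with h | h
          · rw [abs_of_nonneg h, div_mul_eq_mul_div, le_div_iff₀ ha]
            linarith [Real.add_one_le_exp (a * v)]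
          · rw [abs_of_nonpos h]
            have : 0 ≤ 2 / a * Real.exp (a * v) := by positivity
            linarith
        have h3 : 0 ≤ 2 / a * Real.exp (a * v) := by positivity
        have h4 : p z * (|v| + v) ≤ 4 * (2 / a * Real.exp (a * v)) :=
          (mul_le_mul_of_nonneg_left h2 (hppos z).1).trans
            (mul_le_mul_of_nonneg_right (hppos z).2 h3)
        have h5 : 4 * (2 / a * Real.exp (a * v)) = 8 / a * Real.exp (a * v) := by ring
        linarith
      refine le_trans ?_ h1
      by_cases hz : (-R) • z ∈ ball (0 : EuclideanSpace ℝ (Fin (2 * 1))) (R / 2)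
      · simp only [Set.indicator_of_mem hz]
        refine mul_le_mul_of_nonneg_right (hp3 z ?_) (abs_nonneg _)
        rw [mem_ball_zero_iff, norm_smul, norm_neg, Real.norm_of_nonneg hR.le] at hz
        nlinarith
      · simp only [Set.indicator_of_notMem hz]
        rw [mul_zero]
        exact mul_nonneg (hppos z).1 (abs_nonneg _)
    rw [integral_sub (hi3.const_mul _) hi1] at hle
    refine hle.trans ?_
    have h6 := le_abs_self (∫ y, (-Real.log ‖R⁻¹ • ((0 : EuclideanSpace ℝ (Fin (2 * 1))) - y)‖ -
      S (R⁻¹ • (0 - y))) * negLapIter (2 * 1) 1 u y)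
    have h7 := neg_abs_le (b * u 0)
    linarith
  have hlim : Tendsto (fun r : ℝ => 8 / (3 * a) * I * (r ^ 4)⁻¹ +
      (4 / 3 * |b * u 0| * (r ^ 2)⁻¹ + 8 / 3 * C * r⁻¹)) atTop (nhds 0) := by
    have h4 : Tendsto (fun r : ℝ => (r ^ 4)⁻¹) atTop (nhds 0) :=
      (tendsto_pow_atTop (by norm_num)).inv_tendsto_atTop
    have h2 : Tendsto (fun r : ℝ => (r ^ 2)⁻¹) atTop (nhds 0) :=
      (tendsto_pow_atTop (by norm_num)).inv_tendsto_atTop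
    have := (h4.const_mul (8 / (3 * a) * I)).add ((h2.const_mul (4 / 3 * |b * u 0|)).add
      (tendsto_inv_atTop_zero.const_mul (8 / 3 * C)))
    simpa using this
  refine squeeze_zero' ?_ ?_ hlim
  · filter_upwards [eventually_gt_atTop 0] with r hr
    exact mul_nonneg (by positivity) (integral_nonneg fun _ => abs_nonneg _)
  · filter_upwards [eventually_gt_atTop 0] with r hr
    have h := key (2 * r) (by positivity)
    rw [mul_div_cancel_left₀ r (two_ne_zero)] at h
    set J := ∫ y in ball (0 : EuclideanSpace ℝ (Fin (2 * 1))) r, |u y|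
    have h' := mul_le_mul_of_nonneg_left h (by positivity : 0 ≤ 4 / 3 * (r ^ 2)⁻¹)
    have e1 : 4 / 3 * (r ^ 2)⁻¹ * (3 * (((2 * r) ^ (2 * 1))⁻¹ * J)) = (r ^ (2 * 1 + 2))⁻¹ * J := by
      field_simp
      ring
    have e2 : 4 / 3 * (r ^ 2)⁻¹ * (8 / a * (((2 * r) ^ (2 * 1))⁻¹ * I) + (|b * u 0| + C * (2 * r))) =
        8 / (3 * a) * I * (r ^ 4)⁻¹ + (4 / 3 * |b * u 0| * (r ^ 2)⁻¹ + 8 / 3 * C * r⁻¹) := by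
      field_simp
      ring
    rw [e1, e2] at h'
    exact h'

theorem integral_representation (n : ℕ) (hn : 2 ≤ n) (heven : Even n)
    (μ : ℝ) (hμ0 : 0 < μ) (hμn : μ < n)
    (u : EuclideanSpace ℝ (Fin n) → ℝ) (hu : ContDiff ℝ n u)
    (hEq : ∀ x : EuclideanSpace ℝ (Fin n),
      negLapIter n (n / 2) u x = V n μ u x * Real.exp ((2 * n - μ) / 2 * u x))
    (hInt1 : Integrable
      (fun y : EuclideanSpace ℝ (Fin n) => Real.exp ((2 * n - μ) / 2 * u y)))
    (hInt2 : Integrable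
      (fun y : EuclideanSpace ℝ (Fin n) => V n μ u y * Real.exp ((2 * n - μ) / 2 * u y)))
    (hGrowth : 3 ≤ n → ∀ ε > (0 : ℝ), ∃ R : ℝ, ∀ x : EuclideanSpace ℝ (Fin n),
      R ≤ ‖x‖ → |u x| ≤ ε * ‖x‖ ^ 2) :
    ∃ C : ℝ, ∀ x : EuclideanSpace ℝ (Fin n), u x = (1 / betaNFact n) *
      (∫ y, Real.log ((‖y‖ + 1) / ‖x - y‖) *
        (V n μ u y * Real.exp ((2 * n - μ) / 2 * u y))) + C := by
  obtain ⟨m, rfl⟩ := heven.two_dvd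
  have hm : 1 ≤ m := by omega
  rw [Nat.mul_div_cancel_left m two_pos] at hEq
  set f : EuclideanSpace ℝ (Fin (2 * m)) → ℝ :=
    fun y => V (2 * m) μ u y * Real.exp ((2 * (2 * m : ℕ) - μ) / 2 * u y)
  have hfu : negLapIter (2 * m) m u = f := funext hEq
  have hf0 : ∀ y, 0 ≤ f y := fun y =>
    mul_nonneg (integral_nonneg fun _ => by positivity) (Real.exp_pos _).le
  have hf : Continuous f := hfu ▸ (ContDiff.negLapIter m 0 (by simpa using hu)).continuous
  have ha : 0 < (2 * (2 * m : ℕ) - μ) / 2 := by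
    have : (0 : ℝ) < (2 * m : ℕ) := by exact_mod_cast (by omega : 0 < 2 * m)
    linarith
  have hG : Tendsto (fun R : ℝ => (R ^ (2 * m + 2))⁻¹ * ∫ y in ball 0 R, |u y|) atTop
      (nhds 0) := by
    rcases hm.eq_or_lt with rfl | h
    · exact tendsto_mass_of_integrable_exp hu (hfu ▸ hInt2) ha hInt1
    · exact tendsto_mass_of_isLittleO m hu.continuous (hGrowth (by omega))
  have hb : 0 < betaNFact (2 * m) := by
    have : 0 < (volume (ball (0 : EuclideanSpace ℝ (Fin (2 * m))) 1)).toReal :=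
      ENNReal.toReal_pos (measure_ball_pos _ 0 one_pos).ne' measure_ball_lt_top.ne
    unfold betaNFact
    positivity
  set H : EuclideanSpace ℝ (Fin (2 * m)) → ℝ := fun x =>
    betaNFact (2 * m) * u x - ∫ y, Real.log ((‖y‖ + 1) / ‖x - y‖) * f y with hH
  have hup : ∀ x, H x ≤ betaNFact (2 * m) * u x + (∫ y, f y) * Real.log (‖x‖ + 1) := by
    intro x
    have h1 := integral_mono (hInt2.const_mul (-Real.log (‖x‖ + 1)))
      (integrable_log_kernel_mul m hm hf hInt2 x)
      fun y => mul_le_mul_of_nonneg_right (log_kernel_lower x y) (hf0 y)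
    rw [integral_const_mul] at h1
    simp only [hH]
    linarith
  have hconst : ∀ x, H x = H 0 := constant_of_midpoint_affine volume hu.continuous ha hb (integral_nonneg hf0)
    hInt1 (potential_remainder_second_difference m hm hu hfu hInt2 hG fun _ => rfl) hup
  refine ⟨H 0 / betaNFact (2 * m), fun x => ?_⟩
  change u x = 1 / betaNFact (2 * m) *
    (∫ y, Real.log ((‖y‖ + 1) / ‖x - y‖) * f y) + H 0 / betaNFact (2 * m)
  have hx : betaNFact (2 * m) * u x - ∫ y, Real.log ((‖y‖ + 1) / ‖x - y‖) * f y = H 0 := hconst x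
  rw [← hx, one_div_mul_eq_div, ← add_div, add_sub_cancel, mul_div_cancel_left₀ _ hb.ne']
end
end

section
/- Let n ≥ 2 and 0 < μ < n. Suppose u ∈ Cⁿ(ℝⁿ) satisfies condition (B) and the integral equation (IE). Then α > 2n/(2n−μ), and u(x) = −α ln|x| + O(1) at infinity; that is, there exist constants C > 0 and R > 0 such that |u(x) + α ln|x|| ≤ C whenever |x| ≥ R. -/
open MeasureTheory Real Filter Metric

noncomputable section

section Kernels

variable {E : Type*} [NormedAddCommGroup E]

/-- The kernel `‖z‖ ^ (-s)` truncated to the unit ball. -/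
def rieszKer (s : ℝ) (z : E) : ℝ := (ball 0 1).indicator (fun z => ‖z‖ ^ (-s)) z

/-- The kernel `log (1 / ‖z‖)` truncated to the ball of radius `r`. -/
def logKer (r : ℝ) (z : E) : ℝ := (ball 0 r).indicator (fun z => -log ‖z‖) z

/-- The logarithmic potential of the density `w`, normalized by the factor `‖y‖ + 1`. -/
def logPot [MeasureSpace E] (w : E → ℝ) (x : E) : ℝ :=
  ∫ y, log ((‖y‖ + 1) / ‖x - y‖) * w y

lemma rieszKer_nonneg (s : ℝ) (z : E) : 0 ≤ rieszKer s z :=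
  Set.indicator_nonneg (fun _ _ => by positivity) _

lemma logKer_nonneg {r : ℝ} (hr : r ≤ 1) (z : E) : 0 ≤ logKer r z := by
  refine Set.indicator_nonneg (fun z hz => ?_) _
  rw [mem_ball_zero_iff] at hz
  exact neg_nonneg.2 (log_nonpos (norm_nonneg _) (hz.le.trans hr))

lemma logKer_of_lt {r : ℝ} {z : E} (hz : ‖z‖ < r) : logKer r z = -log ‖z‖ :=
  Set.indicator_of_mem (mem_ball_zero_iff.2 hz) _

lemma logKer_of_le {r : ℝ} {z : E} (hz : r ≤ ‖z‖) : logKer r z = 0 :=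
  Set.indicator_of_notMem (by simpa using hz) _

lemma logKer_le_rieszKer {r : ℝ} (hr : r ≤ 1) (z : E) :
    logKer r z ≤ 2 * √r * rieszKer 1 z := by
  rcases le_or_gt r ‖z‖ with hz | hz
  · rw [logKer_of_le hz]
    have := rieszKer_nonneg 1 z
    positivity
  rw [logKer_of_lt hz, rieszKer, Set.indicator_of_mem (mem_ball_zero_iff.2 (hz.trans_le hr))]
  rcases (norm_nonneg z).eq_or_lt with h0 | h0
  · rw [← h0, log_zero, neg_zero]
    positivity
  set t := ‖z‖
  have hs : 0 < √t := sqrt_pos.2 h0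
  have h1 : -log t ≤ 2 * (√t)⁻¹ := by
    have h2 := log_le_sub_one_of_pos (inv_pos.2 hs)
    rw [log_inv, log_sqrt h0.le] at h2
    linarith
  have h3 : (√t)⁻¹ = √t * t ^ (-1 : ℝ) := by
    rw [rpow_neg_one]
    field_simp
    rw [sq_sqrt h0.le]
  calc -log t ≤ 2 * (√t * t ^ (-1 : ℝ)) := h3 ▸ h1
    _ ≤ 2 * (√r * t ^ (-1 : ℝ)) := by gcongr
    _ = _ := by ring

lemma neg_log_le_log_div (x y : E) : -log (1 + ‖x‖) ≤ log ((‖y‖ + 1) / ‖x - y‖) := by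
  rcases (norm_nonneg (x - y)).eq_or_lt with h0 | h0
  · rw [← h0, div_zero, log_zero]
    exact neg_nonpos.2 (log_nonneg (by linarith [norm_nonneg x]))
  rw [← log_inv]
  refine log_le_log (by positivity) ?_
  rw [inv_eq_one_div, div_le_div_iff₀ (by positivity) h0]
  nlinarith [norm_sub_le x y, norm_nonneg x, norm_nonneg y]

lemma log_div_le_logKer {r : ℝ} (hr : 0 < r) (hr1 : r ≤ 1) (x y : E) :
    log ((‖y‖ + 1) / ‖x - y‖) ≤ log (‖x‖ + 2) - log r + logKer r (x - y) := by
  have hx : 0 ≤ log (‖x‖ + 2) := log_nonneg (by linarith [norm_nonneg x])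
  have hlr : log r ≤ 0 := log_nonpos hr.le hr1
  have hy : ‖y‖ ≤ ‖x‖ + ‖x - y‖ := by
    have := norm_sub_norm_le y x
    rw [norm_sub_rev] at this
    linarith
  have hyn := norm_nonneg y
  rcases lt_or_ge ‖x - y‖ r with h | h
  · rw [logKer_of_lt h]
    rcases (norm_nonneg (x - y)).eq_or_lt with h0 | h0
    · rw [← h0, div_zero, log_zero]
      linarith
    rw [log_div (by positivity) h0.ne']
    have : log (‖y‖ + 1) ≤ log (‖x‖ + 2) := log_le_log (by positivity) (by linarith)
    linarith
  · rw [logKer_of_le h, add_zero, ← log_div (by positivity) hr.ne']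
    have h0 : 0 < ‖x - y‖ := hr.trans_le h
    refine log_le_log (by positivity) ?_
    rw [div_le_div_iff₀ h0 hr]
    nlinarith [norm_nonneg x]

lemma log_div_le_of_norm_le {R : ℝ} {x y : E} (hy : ‖y‖ ≤ R) (hx : 2 * R + 1 ≤ ‖x‖) :
    log ((‖y‖ + 1) / ‖x - y‖) ≤ log (2 * (R + 1)) - log ‖x‖ := by
  have hyn := norm_nonneg y
  have hxy := norm_sub_norm_le x y
  have h0 : 0 < ‖x - y‖ := by linarith
  have hx0 : 0 < ‖x‖ := by linarith
  rw [← log_div (by linarith) hx0.ne']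
  refine log_le_log (by positivity) ?_
  rw [div_le_div_iff₀ h0 hx0]
  nlinarith

lemma log_div_add_log_norm_le {x : E} (hx : 1 ≤ ‖x‖) (y : E) :
    log ((‖y‖ + 1) / ‖x - y‖) + log ‖x‖ ≤ 2 * log (1 + ‖y‖) + logKer 1 (x - y) := by
  have hyn := norm_nonneg y
  have hxy : ‖x‖ ≤ ‖y‖ + ‖x - y‖ := by linarith [norm_sub_norm_le x y]
  have hx0 : 0 < ‖x‖ := by linarith
  have hly : 0 ≤ log (1 + ‖y‖) := log_nonneg (by linarith)
  have hk := logKer_nonneg le_rfl (x - y)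
  rcases (norm_nonneg (x - y)).eq_or_lt with h0 | h0
  · rw [← h0, div_zero, log_zero]
    have : log ‖x‖ ≤ log (1 + ‖y‖) := log_le_log hx0 (by linarith)
    linarith
  rw [log_div (by positivity) h0.ne', add_comm ‖y‖ 1]
  rcases lt_or_ge ‖x - y‖ 1 with h | h
  · rw [logKer_of_lt h]
    have : log ‖x‖ ≤ log (1 + ‖y‖) := log_le_log hx0 (by linarith)
    linarith
  · have : log ‖x‖ ≤ log ((1 + ‖y‖) * ‖x - y‖) := log_le_log hx0 (by nlinarith)
    rw [log_mul (by positivity) h0.ne'] at this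
    linarith

lemma logKer_mul_le {w : E → ℝ} {x : E} {r W : ℝ} (hr1 : r ≤ 1)
    (hW : ∀ y ∈ ball x r, w y ≤ W) (hW0 : 0 ≤ W) (y : E) :
    logKer r (x - y) * w y ≤ W * (2 * √r * rieszKer 1 (x - y)) := by
  have hk := rieszKer_nonneg 1 (x - y)
  rcases lt_or_ge ‖x - y‖ r with h | h
  · rw [mul_comm]
    gcongr
    · exact logKer_nonneg hr1 _
    · exact hW y (by rwa [mem_ball', dist_eq_norm])
    · exact logKer_le_rieszKer hr1 _
  · rw [logKer_of_le h, zero_mul]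
    positivity

variable [MeasureSpace E] {w : E → ℝ}

lemma integral_rieszKer_nonneg (s : ℝ) : 0 ≤ ∫ z : E, rieszKer s z :=
  integral_nonneg (rieszKer_nonneg s)

lemma neg_log_mul_le_logPot (hw0 : ∀ y, 0 ≤ w y) (hw : Integrable w) {x : E}
    (hx : Integrable fun y => log ((‖y‖ + 1) / ‖x - y‖) * w y) :
    -log (1 + ‖x‖) * ∫ y, w y ≤ logPot w x := by
  rw [← integral_const_mul]
  exact integral_mono (hw.const_mul _) hx fun y =>
    mul_le_mul_of_nonneg_right (neg_log_le_log_div x y) (hw0 y)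

lemma logPot_add_mul_log_norm_le (hw0 : ∀ y, 0 ≤ w y) (hw : Integrable w) {x : E}
    (hi : Integrable fun y => log ((‖y‖ + 1) / ‖x - y‖) * w y)
    (hk : Integrable fun y => logKer 1 (x - y) * w y)
    (hl : Integrable fun y => log (1 + ‖y‖) * w y) (hx : 1 ≤ ‖x‖) :
    logPot w x + (∫ y, w y) * log ‖x‖ ≤
      2 * (∫ y, log (1 + ‖y‖) * w y) + ∫ y, logKer 1 (x - y) * w y := by
  rw [mul_comm, ← integral_const_mul, logPot, ← integral_add hi (hw.const_mul _),
    ← integral_const_mul, ← integral_add (hl.const_mul _) hk]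
  refine integral_mono (hi.add (hw.const_mul _)) ((hl.const_mul _).add hk) fun y => ?_
  have := mul_le_mul_of_nonneg_right (log_div_add_log_norm_le hx y) (hw0 y)
  simp only
  linarith

variable [BorelSpace E]

lemma measurable_logKer (r : ℝ) : Measurable (logKer r : E → ℝ) :=
  (measurable_log.comp measurable_norm).neg.indicator measurableSet_ball

lemma exists_setIntegral_compl_closedBall_lt (hw : Integrable w) {δ : ℝ} (hδ : 0 < δ) :
    ∃ R : ℝ, 0 ≤ R ∧ ∫ y in (closedBall 0 R)ᶜ, w y < δ := by
  have h := tendsto_setIntegral_of_antitone (f := w) (μ := volume)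
    (s := fun k : ℕ => (closedBall (0 : E) k)ᶜ) (fun k => measurableSet_closedBall.compl)
    (fun a b hab => Set.compl_subset_compl.2 (closedBall_subset_closedBall (by exact_mod_cast hab)))
    ⟨0, hw.integrableOn⟩
  have h0 : ⋂ k : ℕ, (closedBall (0 : E) k)ᶜ = ∅ := by
    rw [← Set.compl_iUnion, iUnion_closedBall_nat, Set.compl_univ]
  rw [h0, setIntegral_empty] at h
  obtain ⟨k, hk⟩ := (h.eventually_lt_const hδ).exists
  exact ⟨k, by positivity, hk⟩

/-- Up to a small multiple of `log ‖x‖` and of `log (1 / r)`, the potential far from the origin is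
that of a point mass plus the contribution of the ball of radius `r`. -/
lemma exists_logPot_le (hw0 : ∀ y, 0 ≤ w y) (hw : Integrable w)
    (hi : ∀ x : E, Integrable fun y => log ((‖y‖ + 1) / ‖x - y‖) * w y)
    (hk : ∀ (x : E) (r : ℝ), r ≤ 1 → Integrable fun y => logKer r (x - y) * w y)
    {δ : ℝ} (hδ : 0 < δ) :
    ∃ R C : ℝ, 1 ≤ R ∧ 0 ≤ C ∧ ∀ x : E, R ≤ ‖x‖ → ∀ r : ℝ, 0 < r → r ≤ 1 →
      logPot w x ≤ -((∫ y, w y) - δ) * log ‖x‖ + C - δ * log r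
        + ∫ y, logKer r (x - y) * w y := by
  obtain ⟨R, hR0, hR⟩ := exists_setIntegral_compl_closedBall_lt hw (half_pos hδ)
  have hA : 0 ≤ ∫ y, w y := integral_nonneg hw0
  have hl3 : 0 ≤ log 3 := log_nonneg (by norm_num)
  have hlR : 0 ≤ log (2 * (R + 1)) := log_nonneg (by linarith)
  refine ⟨2 * R + 1, (∫ y, w y) * log (2 * (R + 1)) + δ * log 3, by linarith, by positivity,
    fun x hx r hr hr1 => ?_⟩
  set S : Set E := closedBall 0 R
  have hS : MeasurableSet S := measurableSet_closedBall
  have hx1 : 1 ≤ ‖x‖ := by linarith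
  have hlx : 0 ≤ log ‖x‖ := log_nonneg hx1
  have hlr : log r ≤ 0 := log_nonpos hr.le hr1
  set τ := ∫ y in Sᶜ, w y
  have hτ0 : 0 ≤ τ := integral_nonneg hw0
  have hsplit : ∫ y in S, w y = (∫ y, w y) - τ := by
    rw [← integral_add_compl hS hw]
    ring
  have hlog : log (‖x‖ + 2) ≤ log 3 + log ‖x‖ := by
    rw [← log_mul (by norm_num) (by positivity)]
    exact log_le_log (by positivity) (by linarith)
  have hmain : logPot w x ≤ ∫ y, ((log (2 * (R + 1)) - log ‖x‖) * S.indicator w y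
      + (log 3 + log ‖x‖ - log r) * Sᶜ.indicator w y + logKer r (x - y) * w y) := by
    refine integral_mono (hi x) ((((hw.indicator hS).const_mul _).add
      ((hw.indicator hS.compl).const_mul _)).add (hk x r hr1)) fun y => ?_
    have hky := logKer_nonneg hr1 (x - y)
    have hwy := hw0 y
    by_cases hy : y ∈ S
    · have h1 := log_div_le_of_norm_le (mem_closedBall_zero_iff.1 hy) hx
      simp only [Set.indicator_of_mem hy, Set.indicator_of_notMem (Set.notMem_compl_iff.2 hy)]
      nlinarith
    · have h1 := log_div_le_logKer hr hr1 x y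
      simp only [Set.indicator_of_notMem hy, Set.indicator_of_mem (Set.mem_compl hy)]
      nlinarith
  have hwS := (hw.indicator hS).const_mul (log (2 * (R + 1)) - log ‖x‖)
  have hwS' := (hw.indicator hS.compl).const_mul (log 3 + log ‖x‖ - log r)
  rw [integral_add (by exact hwS.add hwS') (hk x r hr1), integral_add hwS hwS',
    integral_const_mul, integral_const_mul, integral_indicator hS, integral_indicator hS.compl,
    hsplit] at hmain
  have e1 : τ * log (2 * (R + 1)) ≥ 0 := by positivity
  have e2 : τ * log 3 ≤ δ * log 3 := mul_le_mul_of_nonneg_right (by linarith) hl3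
  have e3 : 2 * τ * log ‖x‖ ≤ δ * log ‖x‖ := mul_le_mul_of_nonneg_right (by linarith) hlx
  have e4 : τ * -log r ≤ δ * -log r := mul_le_mul_of_nonneg_right (by linarith) (by linarith)
  linarith

variable [NormedSpace ℝ E] [FiniteDimensional ℝ E] [(volume : Measure E).IsAddHaarMeasure]

lemma integrable_rieszKer {s : ℝ} (hd : 1 ≤ Module.finrank ℝ E) (hs : s < Module.finrank ℝ E) :
    Integrable (rieszKer s : E → ℝ) := by
  refine (integrable_indicator_iff measurableSet_ball).2
    (integrableOn_ball_of_norm_le_rpow (C := 1) hd hs (.of_forall fun x => ?_)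
      (measurable_norm.pow_const _).aestronglyMeasurable)
  rw [one_mul, norm_of_nonneg (by positivity)]

lemma integrable_logKer_mul (hd : 2 ≤ Module.finrank ℝ E) (hw0 : ∀ y, 0 ≤ w y)
    (hw : AEStronglyMeasurable w) {x : E} {r W : ℝ} (hr1 : r ≤ 1)
    (hW : ∀ y ∈ ball x r, w y ≤ W) (hW0 : 0 ≤ W) :
    Integrable fun y => logKer r (x - y) * w y := by
  have hR : Integrable (rieszKer 1 : E → ℝ) :=
    integrable_rieszKer (by lia) (by exact_mod_cast hd)
  refine (((hR.comp_sub_left x).const_mul (2 * √r)).const_mul W).mono'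
    (((measurable_logKer r).comp (measurable_const.sub measurable_id)).aestronglyMeasurable.mul hw)
    (.of_forall fun y => ?_)
  rw [norm_of_nonneg (mul_nonneg (logKer_nonneg hr1 _) (hw0 y))]
  exact logKer_mul_le hr1 hW hW0 y

lemma integral_logKer_mul_le (hd : 2 ≤ Module.finrank ℝ E) (hw0 : ∀ y, 0 ≤ w y)
    {x : E} {r W : ℝ} (hr1 : r ≤ 1)
    (hW : ∀ y ∈ ball x r, w y ≤ W) (hW0 : 0 ≤ W) :
    ∫ y, logKer r (x - y) * w y ≤ W * (2 * √r * ∫ z : E, rieszKer 1 z) := by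
  have hR : Integrable (rieszKer 1 : E → ℝ) :=
    integrable_rieszKer (by lia) (by exact_mod_cast hd)
  rw [← integral_sub_left_eq_self (rieszKer 1) _ x, ← integral_const_mul, ← integral_const_mul]
  exact integral_mono_of_nonneg
    (.of_forall fun y => mul_nonneg (logKer_nonneg hr1 _) (hw0 y))
    (((hR.comp_sub_left x).const_mul (2 * √r)).const_mul W)
    (.of_forall (logKer_mul_le hr1 hW hW0))

lemma integrable_log_div_mul (hd : 2 ≤ Module.finrank ℝ E) (hw0 : ∀ y, 0 ≤ w y)
    (hw : Integrable w) {x : E} {W : ℝ} (hW : ∀ y ∈ ball x 1, w y ≤ W) :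
    Integrable fun y => log ((‖y‖ + 1) / ‖x - y‖) * w y := by
  have hW0 : 0 ≤ W := (hw0 x).trans (hW x (mem_ball_self one_pos))
  have hK := integrable_logKer_mul hd hw0 hw.1 le_rfl hW hW0
  refine ((hw.const_mul (log (‖x‖ + 2))).add hK).mono'
    (Measurable.aestronglyMeasurable (by fun_prop) |>.mul hw.1) (.of_forall fun y => ?_)
  rw [norm_mul, norm_of_nonneg (hw0 y)]
  simp only [Pi.add_apply]
  rw [← add_mul]
  refine mul_le_mul_of_nonneg_right (abs_le.2 ⟨?_, ?_⟩) (hw0 y)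
  · have h1 := neg_log_le_log_div x y
    have h2 := logKer_nonneg le_rfl (x - y)
    have h3 : log (1 + ‖x‖) ≤ log (‖x‖ + 2) := log_le_log (by positivity) (by linarith)
    linarith
  · simpa using log_div_le_logKer one_pos le_rfl x y

end Kernels

lemma exists_le_mul_of_continuous {X : Type*} [PseudoMetricSpace X] [ProperSpace X] {f : X → ℝ}
    (hf : Continuous f) (hf0 : ∀ x, 0 < f x) (x₀ : X) :
    ∃ (x₁ : X) (d : ℝ), dist x₁ x₀ ≤ 1 ∧ 0 < d ∧ d ≤ 1 ∧ f x₀ ≤ d * f x₁ ∧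
      ∀ z ∈ ball x₁ (d / 2), f z ≤ 2 * f x₁ := by
  obtain ⟨x₁, hx₁, hmax⟩ := (isCompact_closedBall x₀ 1).exists_isMaxOn
    ⟨x₀, mem_closedBall_self zero_le_one⟩
    (f := fun x => (1 - dist x x₀) * f x) (by fun_prop)
  have h0 : f x₀ ≤ (1 - dist x₁ x₀) * f x₁ := by
    simpa using hmax (mem_closedBall_self zero_le_one)
  have hd : 0 < 1 - dist x₁ x₀ := pos_of_mul_pos_left ((hf0 x₀).trans_le h0) (hf0 x₁).le
  refine ⟨x₁, 1 - dist x₁ x₀, hx₁, hd, by linarith [dist_nonneg (x := x₁) (y := x₀)], h0,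
    fun z hz => ?_⟩
  rw [mem_ball] at hz
  have htri := dist_triangle z x₁ x₀
  have hz1 : (1 - dist x₁ x₀) / 2 ≤ 1 - dist z x₀ := by linarith
  have h1 : (1 - dist z x₀) * f z ≤ (1 - dist x₁ x₀) * f x₁ :=
    hmax (mem_closedBall.2 (by linarith))
  have h2 := mul_le_mul_of_nonneg_right hz1 (hf0 z).le
  refine le_of_mul_le_mul_left ?_ hd
  linarith

lemma exists_le_mul_one_add_norm_rpow {E : Type*} [NormedAddCommGroup E] {f : E → ℝ}
    {K R C s : ℝ} (hs : 0 ≤ s) (hR : 1 ≤ R)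
    (hf0 : ∀ x, 0 < f x) (hK : ∀ x, f x ≤ K)
    (hlog : ∀ x, R ≤ ‖x‖ → log (f x) ≤ -s * log ‖x‖ + C) :
    ∃ C', ∀ x, f x ≤ C' * (1 + ‖x‖) ^ (-s) := by
  have hK0 : 0 < K := (hf0 0).trans_le (hK 0)
  refine ⟨K * (1 + R) ^ s + exp C * 2 ^ s, fun x => ?_⟩
  have hx : 0 < 1 + ‖x‖ := by positivity
  rw [rpow_neg hx.le, ← div_eq_mul_inv, le_div_iff₀ (by positivity)]
  rcases le_total R ‖x‖ with h | h
  · have hx0 : 0 < ‖x‖ := by linarith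
    have h1 : f x ≤ exp C * ‖x‖ ^ (-s) := by
      rw [rpow_def_of_pos hx0, ← exp_add, ← log_le_iff_le_exp (hf0 x)]
      linarith [hlog x h]
    have h2 : (1 + ‖x‖) ^ s ≤ 2 ^ s * ‖x‖ ^ s := by
      rw [← mul_rpow (by norm_num) hx0.le]
      exact rpow_le_rpow hx.le (by linarith) hs
    calc f x * (1 + ‖x‖) ^ s ≤ exp C * ‖x‖ ^ (-s) * (2 ^ s * ‖x‖ ^ s) := by gcongr
      _ = exp C * 2 ^ s * (‖x‖ ^ (-s) * ‖x‖ ^ s) := by ring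
      _ = exp C * 2 ^ s := by rw [← rpow_add hx0, neg_add_cancel, rpow_zero, mul_one]
      _ ≤ _ := le_add_of_nonneg_left (by positivity)
  · calc f x * (1 + ‖x‖) ^ s ≤ K * (1 + R) ^ s := by
          gcongr
          exact hK x
      _ ≤ _ := le_add_of_nonneg_right (by positivity)

section Decay

variable {E : Type*} [NormedAddCommGroup E] [NormedSpace ℝ E] [FiniteDimensional ℝ E]
  [MeasureSpace E] [BorelSpace E] [(volume : Measure E).IsAddHaarMeasure] {f v : E → ℝ}

/-- A continuous density is bounded if its logarithm is controlled by arbitrarily short-range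
logarithmic potentials of `v * f`, where `v` is controlled by local bounds on `f`. -/
lemma exists_forall_le_of_log_le {μ I J R C η b : ℝ} (hd : 2 ≤ Module.finrank ℝ E)
    (hμ : μ ≤ Module.finrank ℝ E) (hf : Continuous f) (hf0 : ∀ x, 0 < f x)
    (hv0 : ∀ x, 0 ≤ v x) (hI : 0 ≤ I) (hJ : 0 ≤ J)
    (hv : ∀ y ρ K, 0 < ρ → ρ ≤ 1 → (∀ z ∈ ball y ρ, f z ≤ K) → v y ≤ K * J + ρ ^ (-μ) * I)
    (hη : η * Module.finrank ℝ E ≤ 1 / 4) (hb : 0 ≤ b)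
    (hlog : ∀ x, R ≤ ‖x‖ → ∀ r, 0 < r → r ≤ 1 →
      log (f x) ≤ C - η * log r + b * ∫ y, logKer r (x - y) * (v y * f y)) :
    ∃ K, ∀ x, f x ≤ K := by
  set N := Module.finrank ℝ E
  set J₁ := ∫ z : E, rieszKer 1 z
  have hJ₁ : 0 ≤ J₁ := integral_rieszKer_nonneg 1
  set c := 2 * (2 * J + I)
  set L := 2 * (C + b * (2 * c * J₁)) + log 4
  have hfar : ∀ x, R + 1 ≤ ‖x‖ → f x ≤ max 1 (exp L) := by
    intro x₀ hx₀
    obtain ⟨x₁, d, hx₁, hd0, hd1, hle, hball⟩ := exists_le_mul_of_continuous hf hf0 x₀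
    set M := f x₁
    have hM0 : 0 < M := hf0 x₁
    rcases le_or_gt M 1 with hM | hM
    · exact le_max_of_le_left (hle.trans (by nlinarith))
    refine le_max_of_le_right (hle.trans ?_)
    have hx₁R : R ≤ ‖x₁‖ := by
      rw [dist_eq_norm] at hx₁
      linarith [norm_sub_norm_le x₀ x₁, norm_sub_rev x₀ x₁]
    set D := (d / 4)⁻¹
    have hD1 : 1 ≤ D := (one_le_inv₀ (by positivity)).2 (by linarith)
    set q := (M * D)⁻¹
    have hq0 : 0 < q := by positivity
    have hMD : 1 ≤ M * D := one_le_mul_of_one_le_of_one_le hM.le hD1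
    have hq1 : q ≤ 1 := inv_le_one_of_one_le₀ hMD
    have hqd : q ≤ d / 4 := by
      rw [← inv_inv (d / 4)]
      exact inv_anti₀ (by positivity) (by nlinarith)
    have hr1 : q ^ (2 * N) ≤ 1 := pow_le_one₀ hq0.le hq1
    have hrq : q ^ (2 * N) ≤ q := pow_le_of_le_one hq0.le hq1 (by lia)
    have hsqrt : √(q ^ (2 * N)) = q ^ N := by
      rw [mul_comm, pow_mul, sqrt_sq (by positivity)]
    have hW : ∀ y ∈ ball x₁ (q ^ (2 * N)), v y * f y ≤ c * (M * D) ^ N := by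
      intro y hy
      rw [mem_ball] at hy
      have hyf : f y ≤ 2 * M := hball y (mem_ball.2 (by linarith))
      have hyv := hv y (d / 4) (2 * M) (by positivity) (by linarith) fun z hz => by
        rw [mem_ball] at hz
        exact hball z (mem_ball.2 (by linarith [dist_triangle z y x₁]))
      have hDμ : (d / 4) ^ (-μ) ≤ D ^ N := by
        calc (d / 4) ^ (-μ) ≤ (d / 4) ^ (-(N : ℝ)) :=
              rpow_le_rpow_of_exponent_ge (by positivity) (by linarith) (by linarith)
          _ = D ^ N := by rw [rpow_neg (by positivity), rpow_natCast, inv_pow]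
      have hMN : M ^ 2 ≤ M ^ N := pow_le_pow_right₀ hM.le hd
      have hMN1 : M ≤ M ^ N := le_self_pow₀ hM.le (by lia)
      have hDN : 1 ≤ D ^ N := one_le_pow₀ hD1
      calc v y * f y ≤ (2 * M * J + D ^ N * I) * (2 * M) := by
            refine mul_le_mul (hyv.trans ?_) hyf (hf0 y).le (by positivity)
            gcongr
        _ = 4 * J * (M ^ 2 * 1) + 2 * I * (M * D ^ N) := by ring
        _ ≤ 4 * J * (M ^ N * D ^ N) + 2 * I * (M ^ N * D ^ N) := by gcongr
        _ = c * (M * D) ^ N := by simp only [c]; ring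
    have hint := integral_logKer_mul_le hd (fun y => mul_nonneg (hv0 y) (hf0 y).le) hr1 hW
      (by positivity)
    rw [hsqrt] at hint
    have hcancel : c * (M * D) ^ N * (2 * q ^ N * J₁) = 2 * c * J₁ := by
      have : (M * D) ^ N * q ^ N = 1 := by
        rw [← mul_pow, mul_inv_cancel₀ (by positivity), one_pow]
      linear_combination 2 * c * J₁ * this
    rw [hcancel] at hint
    have hlogr : -log (q ^ (2 * N)) = 2 * N * (log M + log 4 - log d) := by
      rw [log_pow, log_inv, log_mul hM0.ne' (by positivity), log_inv, log_div hd0.ne' (by norm_num)]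
      push_cast
      ring
    have hmain := hlog x₁ hx₁R _ (pow_pos hq0 (2 * N)) hr1
    have hX : 0 ≤ log M + log 4 - log d := by
      have := log_nonneg hM.le
      have := log_nonneg (show (1 : ℝ) ≤ 4 by norm_num)
      have := log_nonpos hd0.le hd1
      linarith
    have h1 : -η * log (q ^ (2 * N)) ≤ 1 / 2 * (log M + log 4 - log d) := by
      calc -η * log (q ^ (2 * N)) = 2 * (η * N) * (log M + log 4 - log d) := by
            linear_combination η * hlogr
        _ ≤ _ := mul_le_mul_of_nonneg_right (by linarith) hX
    have h2 := mul_le_mul_of_nonneg_left hint hb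
    rw [← log_le_iff_le_exp (by positivity), log_mul hd0.ne' hM0.ne']
    linarith
  obtain ⟨K, hK⟩ := (isCompact_closedBall (0 : E) (R + 1)).bddAbove_image hf.continuousOn
  refine ⟨max K (max 1 (exp L)), fun x => ?_⟩
  rcases le_total (R + 1) ‖x‖ with h | h
  · exact le_max_of_le_right (hfar x h)
  · exact le_max_of_le_left (hK ⟨x, mem_closedBall_zero_iff.2 h, rfl⟩)

lemma finrank_lt_of_integrable_one_add_norm (hd : 1 ≤ Module.finrank ℝ E) {s : ℝ}
    (hs : Integrable fun x : E => (1 + ‖x‖) ^ (-s)) : Module.finrank ℝ E < s := by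
  by_contra! hle
  have : Nontrivial E := Module.nontrivial_of_finrank_pos (R := ℝ) hd
  have h := (integrable_fun_norm_addHaar volume (f := fun t => (1 + t) ^ (-s))).1 hs
  set N := Module.finrank ℝ E
  refine not_integrableOn_Ioi_inv (a := 1) (((h.mono_set
    (Set.Ioi_subset_Ioi zero_le_one)).const_mul (2 ^ N)).mono' (by fun_prop) ?_)
  refine (ae_restrict_iff' measurableSet_Ioi).2 (.of_forall fun t (ht : 1 < t) => ?_)
  have ht0 : 0 < t := by linarith
  rw [norm_of_nonneg (by positivity), smul_eq_mul]
  have h1 : ((2 * t) ^ N)⁻¹ ≤ (1 + t) ^ (-s) := by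
    calc ((2 * t) ^ N)⁻¹ ≤ ((1 + t) ^ N)⁻¹ := by gcongr; linarith
      _ = (1 + t) ^ (-(N : ℝ)) := by rw [rpow_neg (by positivity), rpow_natCast]
      _ ≤ _ := rpow_le_rpow_of_exponent_le (by linarith) (by linarith)
  calc t⁻¹ = 2 ^ N * (t ^ (N - 1) * ((2 * t) ^ N)⁻¹) := by
        obtain ⟨m, hm⟩ : ∃ m, N = m + 1 := ⟨N - 1, by lia⟩
        rw [hm, Nat.add_sub_cancel, mul_pow]
        field_simp
        ring
    _ ≤ _ := by gcongr

lemma integrable_log_mul_of_le {s C : ℝ} (hs : Module.finrank ℝ E < s)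
    (hf : AEStronglyMeasurable f) (hf0 : ∀ x, 0 ≤ f x)
    (hle : ∀ x, f x ≤ C * (1 + ‖x‖) ^ (-s)) :
    Integrable fun x => log (1 + ‖x‖) * f x := by
  set ε := (s - Module.finrank ℝ E) / 2
  have hε : 0 < ε := half_pos (sub_pos.2 hs)
  have hi : Integrable fun x : E => (1 + ‖x‖) ^ (-(s - ε)) :=
    integrable_one_add_norm (by simp only [ε]; linarith)
  refine (hi.const_mul (C / ε)).mono'
    ((Measurable.aestronglyMeasurable (by fun_prop)).mul hf) (.of_forall fun x => ?_)
  have hx : 0 < 1 + ‖x‖ := by positivity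
  have hl : 0 ≤ log (1 + ‖x‖) := log_nonneg (by linarith [norm_nonneg x])
  rw [norm_of_nonneg (mul_nonneg hl (hf0 x))]
  calc log (1 + ‖x‖) * f x
      ≤ (1 + ‖x‖) ^ ε / ε * (C * (1 + ‖x‖) ^ (-s)) :=
        mul_le_mul (log_le_rpow_div hx.le hε) (hle x) (hf0 x) (by positivity)
    _ = C / ε * ((1 + ‖x‖) ^ ε * (1 + ‖x‖) ^ (-s)) := by ring
    _ = _ := by rw [← rpow_add hx]; congr 2; ring

end Decay

lemma betaN_pos {n : ℕ} (hn : 0 < n) : 0 < betaN n := by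
  have h1 : 0 < Real.Gamma ((n : ℝ) / 2 + 1) := Real.Gamma_pos_of_pos (by positivity)
  have h2 : 0 < Real.Gamma ((n : ℝ) / 2) := Real.Gamma_pos_of_pos (by positivity)
  have h3 : 0 < (volume (ball (0 : EuclideanSpace ℝ (Fin n)) 1)).toReal :=
    ENNReal.toReal_pos (measure_ball_pos _ _ one_pos).ne' measure_ball_lt_top.ne
  unfold betaN
  positivity

section ConvolutionTerm

variable {n : ℕ} {μ : ℝ} {u : EuclideanSpace ℝ (Fin n) → ℝ}

lemma V_nonneg (x : EuclideanSpace ℝ (Fin n)) : 0 ≤ V n μ u x :=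
  integral_nonneg fun y => by positivity

lemma V_le (hn : 0 < n) (hμ0 : 0 ≤ μ) (hμn : μ < n)
    (hf : Integrable fun y => exp ((2 * n - μ) / 2 * u y))
    (y : EuclideanSpace ℝ (Fin n)) (ρ K : ℝ) (hρ0 : 0 < ρ) (hρ1 : ρ ≤ 1)
    (hK : ∀ z ∈ ball y ρ, exp ((2 * n - μ) / 2 * u z) ≤ K) :
    V n μ u y ≤ K * (∫ z : EuclideanSpace ℝ (Fin n), rieszKer μ z)
      + ρ ^ (-μ) * ∫ z, exp ((2 * n - μ) / 2 * u z) := by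
  have hK0 : 0 ≤ K := (exp_pos _).le.trans (hK y (mem_ball_self hρ0))
  have hR : Integrable (rieszKer μ : EuclideanSpace ℝ (Fin n) → ℝ) :=
    integrable_rieszKer (by rw [finrank_euclideanSpace_fin]; exact hn) (by simpa using hμn)
  have hR' := (hR.comp_sub_left y).const_mul K
  rw [← integral_sub_left_eq_self (rieszKer μ) _ y, ← integral_const_mul, ← integral_const_mul,
    ← integral_add hR' (hf.const_mul _)]
  refine integral_mono_of_nonneg (.of_forall fun z => by positivity) (hR'.add (hf.const_mul _))
    (.of_forall fun z => ?_)
  simp only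
  rw [div_eq_mul_inv, ← rpow_neg (norm_nonneg _)]
  rcases lt_or_ge ‖y - z‖ ρ with h | h
  · have h1 : rieszKer μ (y - z) = ‖y - z‖ ^ (-μ) :=
      Set.indicator_of_mem (mem_ball_zero_iff.2 (h.trans_le hρ1)) _
    rw [h1]
    refine le_add_of_le_of_nonneg ?_ (by positivity)
    gcongr
    exact hK z (by rwa [mem_ball', dist_eq_norm])
  · have h1 := rieszKer_nonneg μ (y - z)
    refine le_add_of_nonneg_of_le (by positivity) ?_
    rw [mul_comm]
    exact mul_le_mul_of_nonneg_right (rpow_le_rpow_of_nonpos hρ0 h (by linarith)) (exp_pos _).le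

lemma CondB.integrable_V_mul (hB : CondB n μ u) :
    Integrable fun y => V n μ u y * exp ((2 * n - μ) / 2 * u y) := by
  refine (Integrable.integral_prod_left hB.2).congr (.of_forall fun x => ?_)
  simp only [V, mul_div_assoc]
  rw [integral_const_mul, mul_comm]

lemma exists_V_mul_le (hn : 0 < n) (hμ0 : 0 ≤ μ) (hμn : μ < n) (hu : Continuous u)
    (hf : Integrable fun y => exp ((2 * n - μ) / 2 * u y)) (x : EuclideanSpace ℝ (Fin n)) :
    ∃ W, 0 ≤ W ∧ ∀ y ∈ ball x 1, V n μ u y * exp ((2 * n - μ) / 2 * u y) ≤ W := by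
  have hc : Continuous fun y => exp ((2 * n - μ) / 2 * u y) := by fun_prop
  obtain ⟨K, hK⟩ := (isCompact_closedBall x 2).bddAbove_image hc.continuousOn
  have hK' : ∀ z ∈ closedBall x 2, exp ((2 * n - μ) / 2 * u z) ≤ K := fun z hz => hK ⟨z, hz, rfl⟩
  have hK0 : 0 ≤ K := (exp_pos _).le.trans (hK' x (mem_closedBall_self zero_le_two))
  have hJ := integral_rieszKer_nonneg (E := EuclideanSpace ℝ (Fin n)) μ
  have hI : 0 ≤ ∫ z, exp ((2 * n - μ) / 2 * u z) := integral_nonneg fun z => (exp_pos _).le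
  refine ⟨_, ?_, fun y hy => mul_le_mul
    (V_le hn hμ0 hμn hf y 1 K one_pos le_rfl fun z hz => hK' z ?_) (hK' y ?_) (exp_pos _).le ?_⟩
  · positivity
  · rw [mem_ball] at hy hz
    rw [mem_closedBall]
    linarith [dist_triangle z y x]
  · exact (ball_subset_closedBall.trans (closedBall_subset_closedBall one_le_two)) hy
  · positivity

end ConvolutionTerm

theorem asymptotics_of_u (n : ℕ) (hn : 2 ≤ n) (μ : ℝ) (hμ0 : 0 < μ) (hμn : μ < n)
    (u : EuclideanSpace ℝ (Fin n) → ℝ) (hu : ContDiff ℝ n u)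
    (hB : CondB n μ u) (hIE : IE n μ u) :
    alphaC n μ u > 2 * n / (2 * n - μ) ∧
    ∃ C > (0 : ℝ), ∃ R > (0 : ℝ), ∀ x : EuclideanSpace ℝ (Fin n), R ≤ ‖x‖ →
      |u x + alphaC n μ u * Real.log ‖x‖| ≤ C := by
  obtain ⟨C₀, hIE⟩ := hIE
  have hn0 : 0 < n := by lia
  have hdim : Module.finrank ℝ (EuclideanSpace ℝ (Fin n)) = n := by simp
  have hd2 : 2 ≤ Module.finrank ℝ (EuclideanSpace ℝ (Fin n)) := by rwa [hdim]
  have hβ := betaN_pos hn0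
  have huc := hu.continuous
  have hfi := hB.1
  have hwi := hB.integrable_V_mul
  set β := betaN n
  have hk : 0 < (2 * n - μ) / 2 := by
    have : (0 : ℝ) ≤ n := n.cast_nonneg
    linarith
  have hα : 2 * n / (2 * n - μ) = n / ((2 * n - μ) / 2) := by
    field_simp
  have hVle := V_le hn0 hμ0.le hμn hfi
  have hWloc := exists_V_mul_le hn0 hμ0.le hμn huc hfi
  rw [gt_iff_lt, hα, div_lt_iff₀ hk]
  clear hα
  set k := (2 * n - μ) / 2
  set f : EuclideanSpace ℝ (Fin n) → ℝ := fun y => exp (k * u y)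
  have hf0 : ∀ x, 0 < f x := fun x => exp_pos _
  have hfc : Continuous f := by fun_prop
  have hlogf : ∀ x, log (f x) = k * u x := fun x => log_exp _
  set w : EuclideanSpace ℝ (Fin n) → ℝ := fun y => V n μ u y * f y
  have hw0 : ∀ y, 0 ≤ w y := fun y => mul_nonneg (V_nonneg y) (hf0 y).le
  set A := ∫ y, w y
  have hA0 : 0 ≤ A := integral_nonneg hw0
  have hαA : alphaC n μ u = 1 / β * A := rfl
  have hux : ∀ x, u x = 1 / β * logPot w x + C₀ := hIE
  have hi : ∀ x, Integrable fun y => log ((‖y‖ + 1) / ‖x - y‖) * w y := fun x => by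
    obtain ⟨W, -, hW⟩ := hWloc x
    exact integrable_log_div_mul hd2 hw0 hwi hW
  have hki : ∀ (x : EuclideanSpace ℝ (Fin n)) (r : ℝ), r ≤ 1 →
      Integrable fun y => logKer r (x - y) * w y := fun x r hr => by
    obtain ⟨W, hW0, hW⟩ := hWloc x
    exact integrable_logKer_mul hd2 hw0 hwi.1 hr
      (fun y hy => hW y (ball_subset_ball hr hy)) hW0
  have hlow : ∀ x, -(1 / β * A) * log (1 + ‖x‖) + C₀ ≤ u x := fun x => by
    rw [hux x]
    have := mul_le_mul_of_nonneg_left (neg_log_mul_le_logPot hw0 hwi (hi x)) (one_div_pos.2 hβ).le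
    linarith
  set α := 1 / β * A
  have hα0 : 0 ≤ α := by positivity
  have hnα : n < α * k := by
    have h := finrank_lt_of_integrable_one_add_norm (E := EuclideanSpace ℝ (Fin n))
      (one_le_two.trans hd2) (s := α * k) ((hfi.const_mul (exp (-(k * C₀)))).mono'
        (Measurable.aestronglyMeasurable (by fun_prop)) (.of_forall fun x => ?_))
    · rwa [hdim] at h
    · have hx : 0 < 1 + ‖x‖ := by positivity
      rw [norm_of_nonneg (by positivity), rpow_def_of_pos hx, ← exp_add, exp_le_exp]
      have := mul_le_mul_of_nonneg_left (hlow x) hk.le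
      linarith
  refine ⟨by rwa [hαA], ?_⟩
  have hn' : (0 : ℝ) < n := by exact_mod_cast hn0
  set η := min (1 / (4 * (n : ℝ))) ((α * k - n) / 2)
  have hη0 : 0 < η := lt_min (by positivity) (by linarith)
  have hηn : η * n ≤ 1 / 4 := by
    calc η * n ≤ 1 / (4 * (n : ℝ)) * n := by gcongr; exact min_le_left _ _
      _ = 1 / 4 := by field_simp
  have hηα : n < α * k - η := by
    have : η ≤ (α * k - n) / 2 := min_le_right _ _
    linarith
  obtain ⟨R, C, hR1, hC0, hpot⟩ := exists_logPot_le hw0 hwi hi hki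
    (δ := η * β / k) (by positivity)
  have hlogle : ∀ x, R ≤ ‖x‖ → ∀ r, 0 < r → r ≤ 1 →
      log (f x) ≤ -(α * k - η) * log ‖x‖ + (k / β * C + k * C₀) - η * log r
        + k / β * ∫ y, logKer r (x - y) * w y := fun x hx r hr hr1 => by
    rw [hlogf, hux]
    have h := mul_le_mul_of_nonneg_left (hpot x hx r hr hr1) (show 0 ≤ k / β by positivity)
    have e1 : k / β * (η * β / k) = η := by field_simp
    have e2 : α * k = k / β * A := by simp only [α]; ring
    rw [e2]
    calc k * (1 / β * logPot w x + C₀) = k / β * logPot w x + k * C₀ := by ring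
      _ ≤ _ := add_le_add_left h _
      _ = _ := by linear_combination (log ‖x‖ - log r) * e1
  obtain ⟨K, hK⟩ := exists_forall_le_of_log_le (R := R) (C := k / β * C + k * C₀) (η := η)
    (b := k / β) (v := V n μ u) hd2 (by rw [hdim]; exact hμn.le) hfc hf0 V_nonneg
    (integral_nonneg fun z => (hf0 z).le) (integral_rieszKer_nonneg μ) hVle
    (by rwa [hdim]) (by positivity) fun x hx r hr hr1 => by
      have h1 := hlogle x hx r hr hr1
      have h2 : 0 ≤ (α * k - η) * log ‖x‖ :=
        mul_nonneg (by linarith) (log_nonneg (by linarith))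
      linarith
  have hVb := fun y => hVle y 1 K one_pos le_rfl fun z _ => hK z
  set B := K * (∫ z : EuclideanSpace ℝ (Fin n), rieszKer μ z) + 1 ^ (-μ) * ∫ z, f z
  have hB0 : 0 ≤ B := (V_nonneg 0).trans (hVb 0)
  have hK0 : 0 ≤ K := (hf0 0).le.trans (hK 0)
  have hwb : ∀ y, w y ≤ B * K := fun y => mul_le_mul (hVb y) (hK y) (hf0 y).le hB0
  set G := B * K * (2 * √1 * ∫ z : EuclideanSpace ℝ (Fin n), rieszKer 1 z)
  have hG : ∀ x, ∫ y, logKer 1 (x - y) * w y ≤ G := fun x =>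
    integral_logKer_mul_le hd2 hw0 le_rfl (fun y _ => hwb y) (by positivity)
  obtain ⟨C', hC'⟩ := exists_le_mul_one_add_norm_rpow (s := α * k - η)
    (C := k / β * C + k * C₀ + k / β * G) (by linarith) hR1 hf0 hK fun x hx => by
      have h1 := hlogle x hx 1 one_pos le_rfl
      have h2 := mul_le_mul_of_nonneg_left (hG x) (show 0 ≤ k / β by positivity)
      rw [log_one] at h1
      linarith
  have hmom : Integrable fun y => log (1 + ‖y‖) * w y := by
    refine integrable_log_mul_of_le (s := α * k - η) (C := B * C') (by rwa [hdim]) hwi.1 hw0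
      fun y => ?_
    rw [mul_assoc]
    exact mul_le_mul (hVb y) (hC' y) (hf0 y).le hB0
  set T := 1 / β * (2 * (∫ y, log (1 + ‖y‖) * w y) + G) + C₀
  refine ⟨|T| + |α * log 2 - C₀| + 1, by positivity, 1, one_pos, fun x hx => ?_⟩
  rw [hαA, abs_le]
  constructor
  · have h1 := hlow x
    have h2 : log (1 + ‖x‖) ≤ log 2 + log ‖x‖ := by
      rw [← log_mul (by norm_num) (by positivity)]
      exact log_le_log (by positivity) (by linarith)
    have h3 := mul_le_mul_of_nonneg_left h2 hα0
    have h4 := le_abs_self (α * log 2 - C₀)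
    have h5 := abs_nonneg T
    linarith
  · have h1 := logPot_add_mul_log_norm_le hw0 hwi (hi x) (hki x 1 le_rfl) hmom hx
    have h2 := mul_le_mul_of_nonneg_left (h1.trans (add_le_add_right (hG x) _))
      (one_div_pos.2 hβ).le
    have h3 : u x + α * log ‖x‖ = 1 / β * (logPot w x + A * log ‖x‖) + C₀ := by
      rw [hux x]
      simp only [α]
      ring
    have h4 := le_abs_self T
    have h5 := abs_nonneg (α * log 2 - C₀)
    linarith
end
end
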